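/- Every smooth function I : T*U → ℝ which is polynomial in momenta of degree ≤ 6 and satisfies {H, I} = 0, {p_φ, I} = 0 and {p_t, I} = 0 is a polynomial in H, p_φ and p_t; more precisely, there exist real constants c_{abc}, for nonnegative integers a, b, c with 2a + b + c ≤ 6, such that I = Σ c_{abc}·H^a·p_φ^b·p_t^c identically on T*U. -/

import Mathlib

open Real Finset

noncomputable section

/-- A phase-space point `(x, y, φ, t, p_x, p_y, p_φ, p_t)` of `T*U ⊂ ℝ⁴ × ℝ⁴`. -/
abbrev PhasePt := Fin 8 → ℝ

/-- The phase space `T*U` over `U = {x > 1, -1 < y < 1}`. -/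
def TStar : Set PhasePt := {z | 1 < z 0 ∧ -1 < z 1 ∧ z 1 < 1}

/-- The base domain `U`. -/
def Ubase : Set (Fin 4 → ℝ) := {w | 1 < w 0 ∧ -1 < w 1 ∧ w 1 < 1}

/-- Projection to the base coordinates `(x, y, φ, t)`. -/
def basePt (z : PhasePt) : Fin 4 → ℝ := fun q => z ⟨q.1, by omega⟩

/-- Partial derivative in the `i`-th coordinate. -/
def pd (i : Fin 8) (f : PhasePt → ℝ) (z : PhasePt) : ℝ :=
  fderiv ℝ f z (Pi.single i 1)

/-- The canonical Poisson bracket on `T*U`. -/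
def pois (f g : PhasePt → ℝ) (z : PhasePt) : ℝ :=
    (pd 0 f z * pd 4 g z - pd 4 f z * pd 0 g z)
  + (pd 1 f z * pd 5 g z - pd 5 f z * pd 1 g z)
  + (pd 2 f z * pd 6 g z - pd 6 f z * pd 2 g z)
  + (pd 3 f z * pd 7 g z - pd 7 f z * pd 3 g z)

/-- The geodesic Hamiltonian of the Zipoy-Voorhees metric with parameter `δ = 2`. -/
def Ham (z : PhasePt) : ℝ :=
  (1/2) * ( (((z 0)^2 - 1) * (z 4)^2 + (1 - (z 1)^2) * (z 5)^2)
      / ((((z 0 + 1)/(z 0 - 1))^2) * (((z 0)^2 - 1)^4 / ((z 0)^2 - (z 1)^2)^3))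
    + (z 6)^2 / ((((z 0 + 1)/(z 0 - 1))^2) * (((z 0)^2 - 1) * (1 - (z 1)^2)))
    - ((z 0 + 1)/(z 0 - 1))^2 * (z 7)^2 )

/-- The momentum `p_φ`. -/
def Pphi (z : PhasePt) : ℝ := z 6

/-- The momentum `p_t`. -/
def Ptm (z : PhasePt) : ℝ := z 7

/-- `I` is polynomial in momenta of degree `≤ d`, with smooth coefficients. -/
def IsPolyMom (d : ℕ) (I : PhasePt → ℝ) : Prop :=
  ∃ c : ℕ → ℕ → ℕ → ℕ → ((Fin 4 → ℝ) → ℝ),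
    (∀ i j k m, ContDiffOn ℝ (⊤ : ℕ∞) (c i j k m) Ubase) ∧
    ∀ z ∈ TStar, I z =
      ∑ i ∈ Finset.range (d+1), ∑ j ∈ Finset.range (d+1),
      ∑ k ∈ Finset.range (d+1), ∑ m ∈ Finset.range (d+1),
        (if i + j + k + m ≤ d then
          c i j k m (basePt z) * (z 4)^i * (z 5)^j * (z 6)^k * (z 7)^m else 0)

/-- `I` is a homogeneous polynomial in momenta of degree `d`, with smooth coefficients. -/
def IsHomPolyMom (d : ℕ) (I : PhasePt → ℝ) : Prop :=
  ∃ c : ℕ → ℕ → ℕ → ℕ → ((Fin 4 → ℝ) → ℝ),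
    (∀ i j k m, ContDiffOn ℝ (⊤ : ℕ∞) (c i j k m) Ubase) ∧
    ∀ z ∈ TStar, I z =
      ∑ i ∈ Finset.range (d+1), ∑ j ∈ Finset.range (d+1),
      ∑ k ∈ Finset.range (d+1), ∑ m ∈ Finset.range (d+1),
        (if i + j + k + m = d then
          c i j k m (basePt z) * (z 4)^i * (z 5)^j * (z 6)^k * (z 7)^m else 0)

/-- Functional independence: the differentials are linearly independent at every point
of a dense subset of `T*U`. -/
def FunIndep (f₁ f₂ f₃ f₄ : PhasePt → ℝ) : Prop :=
  ∃ S : Set PhasePt, S ⊆ TStar ∧ TStar ⊆ closure S ∧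
    ∀ z ∈ S, LinearIndependent ℝ
      ![fderiv ℝ f₁ z, fderiv ℝ f₂ z, fderiv ℝ f₃ z, fderiv ℝ f₄ z]


namespace NV
abbrev Pl := List ℤ
abbrev Term := ℤ × ℤ × List ℤ
def padd : List ℤ → List ℤ → List ℤ
  | [], b => b
  | x :: a, [] => x :: a
  | x :: a, y :: b => (x + y) :: padd a b
def psc (k : ℤ) : List ℤ → List ℤ
  | [] => []
  | x :: a => (k * x) :: psc k a
def pX (l : List ℤ) : List ℤ := 0 :: l
def psq (l : List ℤ) : List ℤ := padd l (padd (psc 2 (pX l)) (pX (pX l)))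
def pder : List ℤ → List ℤ
  | [] => []
  | _ :: l => padd l (pX (pder l))
def ins (e : Term) : List Term → List Term
  | [] => [e]
  | f :: r => if e.1 = f.1 ∧ e.2.1 = f.2.1 then (f.1, f.2.1, padd e.2.2 f.2.2) :: r
      else f :: ins e r
def inR (w M j t : ℤ) : Bool := decide (0 ≤ j) && decide (j ≤ M) && decide (0 ≤ t) && decide (j + 2 * t ≤ w)
def insR (w M : ℤ) (e : Term) (r : List Term) : List Term :=
  match inR w M e.1 e.2.1 with
  | true => ins e r
  | false => r
/-- contributions of one term to the derived row -/
def step1 (w M : ℤ) (e : Term) (acc : List Term) : List Term :=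
  insR w M (e.1, e.2.1, padd (psc (-2) (pX (psq (pder e.2.2))))
      (padd (psc (-(w - e.1 - 2 * e.2.1)) (psq e.2.2)) (psc (-6 * e.1) (padd e.2.2 (pX e.2.2)))))
    (insR w M (e.1, e.2.1 - 1, psc (2 * (w - e.1 - 2 * e.2.1 + 2)) (pX (psq e.2.2)))
      (insR w M (e.1 - 1, e.2.1, psc (-(M - e.1 + 1)) (psq e.2.2))
        (insR w M (e.1 + 1, e.2.1, psc (-12 * (e.1 + 1)) (pX e.2.2)) acc)))
def step (w M : ℤ) (zero : List Term) : List Term → List Term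
  | [] => zero
  | e :: r => step1 w M e (step w M zero r)
def pev (c0 : ℤ) : List ℤ → ℤ
  | [] => 0
  | a :: l => a + c0 * pev c0 l
def zeroRow (w M : ℤ) : List Term :=
  ([0,1,2,3,4,5,6] : List ℤ).flatMap fun j => ([0,1,2,3] : List ℤ).flatMap fun t =>
    match inR w M j t with
    | true => [(j, t, [])]
    | false => []
def row0 (w M t : ℤ) : List Term :=
  insR w M (w + 1 - 2 * t, t - 1, [0, 2]) (insR w M (w - 2 * t, t, [-(M - (w + 1 - 2 * t) + 1)]) (zeroRow w M))
def iter (w M : ℤ) : ℕ → List Term → List (List Term)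
  | 0, _ => []
  | n + 1, r => r :: iter w M n (step w M (zeroRow w M) r)
def vec (r : List Term) : List ℤ := r.map fun e => pev 2 e.2.2
def allRows (w M : ℤ) (n : ℕ) : List (List ℤ) :=
  (([0,1,2,3] : List ℤ).flatMap fun t =>
    if w + 1 - 2 * t ≤ M then iter w M n (row0 w M t) else []).map vec
def lgcd : List ℤ → ℕ
  | [] => 0
  | a :: l => Nat.gcd a.natAbs (lgcd l)
def red (p0 : ℤ) (p : List ℤ) : List ℤ → List ℤ
  | [] => []
  | r0 :: r =>
    let v := padd (psc p0 r) (psc (-r0) p)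
    let d : ℤ := lgcd v
    let v' := v.map (fun a => a / d)
    if psc d v' = v ∧ d ≠ 0 then v' else v
def findp : List (List ℤ) → Option (ℤ × List ℤ)
  | [] => none
  | [] :: rs => findp rs
  | (a :: l) :: rs => if a ≠ 0 then some (a, l) else findp rs
def elim : ℕ → List (List ℤ) → Bool
  | 0, _ => true
  | n + 1, rows => match findp rows with
    | none => false
    | some (a, l) => elim n (rows.map (red a l))
def chk (w M : ℤ) (n : ℕ) : Bool := elim (zeroRow w M).length (allRows w M n)
end NV
section linode
open Set
theorem lin_ode {ι : Type*} [Fintype ι] (G : ι → ℝ → ℝ) (m : ι → ι → ℝ → ℝ)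
    (hm : ∀ a b, ContinuousOn (m a b) (Ioi 1))
    (hG : ∀ a, ∀ x > 1, HasDerivAt (G a) (∑ b, m a b x * G b x) x)
    (x0 : ℝ) (hx0 : 1 < x0) (h0 : ∀ a, G a x0 = 0) : ∀ a, ∀ x > 1, G a x = 0 := by
  intro a x hx
  set l := (1 + min x x0) / 2 with hl
  set u := max x x0 + 1 with hu
  have hmin : 1 < min x x0 := lt_min hx hx0
  have hl1 : 1 < l := by rw [hl]; linarith
  have hlm : l < min x x0 := by rw [hl]; linarith
  have hlx : l < x := lt_of_lt_of_le hlm (min_le_left _ _)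
  have hlx0 : l < x0 := lt_of_lt_of_le hlm (min_le_right _ _)
  have hux : x < u := by rw [hu]; linarith [le_max_left x x0]
  have hux0 : x0 < u := by rw [hu]; linarith [le_max_right x x0]
  have hb : ∀ a b, ∃ C, ∀ t ∈ Icc l u, ‖m a b t‖ ≤ C := fun a b =>
    isCompact_Icc.exists_bound_of_continuousOn
      ((hm a b).mono fun t ht => lt_of_lt_of_le hl1 ht.1)
  choose C hC using hb
  set K : ℝ := ∑ a, ∑ b, |C a b| with hK
  have hK0 : 0 ≤ K := Finset.sum_nonneg fun _ _ => Finset.sum_nonneg fun _ _ => abs_nonneg _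
  have key := ODE_solution_unique_of_mem_Ioo (E := ι → ℝ)
    (v := fun t y => fun a => ∑ b, m a b t * y b) (s := fun _ => Set.univ) (K := K.toNNReal)
    (f := fun t a => G a t) (g := fun _ => 0) (t₀ := x0) (a := l) (b := u) ?_ ⟨hlx0, hux0⟩ ?_ ?_ ?_
  · have := key (show x ∈ Ioo l u from ⟨hlx, hux⟩)
    exact congrFun this a
  · intro t ht
    refine LipschitzOnWith.of_dist_le_mul ?_
    intro y _ y' _
    rw [Real.coe_toNNReal K hK0]
    refine (dist_pi_le_iff (by positivity)).2 fun a => ?_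
    rw [Real.dist_eq, ← Finset.sum_sub_distrib]
    calc |∑ b, (m a b t * y b - m a b t * y' b)| ≤ ∑ b, |m a b t * y b - m a b t * y' b| :=
          Finset.abs_sum_le_sum_abs _ _
      _ ≤ ∑ b, |C a b| * dist y y' := by
          refine Finset.sum_le_sum fun b _ => ?_
          rw [← mul_sub, abs_mul]
          refine mul_le_mul ?_ ?_ (abs_nonneg _) (abs_nonneg _)
          · exact (hC a b t ⟨ht.1.le, ht.2.le⟩).trans (le_abs_self _)
          · rw [← Real.dist_eq]; exact dist_le_pi_dist y y' b
      _ = (∑ b, |C a b|) * dist y y' := by rw [Finset.sum_mul]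
      _ ≤ K * dist y y' := by
          refine mul_le_mul_of_nonneg_right ?_ dist_nonneg
          exact Finset.single_le_sum (f := fun a => ∑ b, |C a b|)
            (fun _ _ => Finset.sum_nonneg fun _ _ => abs_nonneg _) (Finset.mem_univ a)
  · intro t ht
    exact ⟨hasDerivAt_pi.2 fun a => hG a t (hl1.trans ht.1), trivial⟩
  · intro t _
    refine ⟨?_, trivial⟩
    have : (fun a => ∑ b, m a b t * (0 : ι → ℝ) b) = (0 : ι → ℝ) := by ext; simp
    rw [this]
    exact hasDerivAt_const t (0 : ι → ℝ)
  · ext a; exact h0 a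
end linode
namespace NV
def ev (l : List ℤ) (c : ℝ) : ℝ := match l with
  | [] => 0
  | a :: l => a + c * ev l c
theorem ev_padd (a b : List ℤ) (c : ℝ) : ev (padd a b) c = ev a c + ev b c := by
  induction a generalizing b with
  | nil => simp [padd, ev]
  | cons x a ih =>
    cases b with
    | nil => simp [padd, ev]
    | cons y b => simp only [padd, ev, ih]; push_cast; ring
theorem ev_psc (k : ℤ) (a : List ℤ) (c : ℝ) : ev (psc k a) c = k * ev a c := by
  induction a with
  | nil => simp [psc, ev]
  | cons x a ih => simp only [psc, ev, ih]; push_cast; ring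
theorem ev_pX (a : List ℤ) (c : ℝ) : ev (pX a) c = c * ev a c := by
  simp [pX, ev]
theorem ev_psq (a : List ℤ) (c : ℝ) : ev (psq a) c = (c + 1) ^ 2 * ev a c := by
  simp only [psq, ev_padd, ev_psc, ev_pX]; push_cast; ring
theorem ev_der (a : List ℤ) (c : ℝ) : HasDerivAt (fun c => ev a c) (ev (pder a) c) c := by
  induction a with
  | nil => simpa [pder, ev] using hasDerivAt_const c (0:ℝ)
  | cons x a ih =>
    simp only [pder, ev, ev_padd, ev_pX]
    have := ((hasDerivAt_id c).mul ih).const_add (x:ℝ)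
    refine this.congr_deriv ?_
    simp [id]
theorem ev_pev (l : List ℤ) (c0 : ℤ) : ev l c0 = pev c0 l := by
  induction l with
  | nil => simp [ev, pev]
  | cons a l ih => simp [ev, pev, ih]
/-- value of a row -/
def S (g : ℤ → ℤ → ℝ) (c : ℝ) : List Term → ℝ
  | [] => 0
  | e :: r => ev e.2.2 c * g e.1 e.2.1 + S g c r
theorem S_ins (g : ℤ → ℤ → ℝ) (c : ℝ) (e : Term) (r : List Term) :
    S g c (ins e r) = ev e.2.2 c * g e.1 e.2.1 + S g c r := by
  induction r with
  | nil => simp [ins, S]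
  | cons f r ih =>
    simp only [ins]
    split_ifs with h
    · simp only [S, ev_padd, h.1, h.2]; ring
    · simp only [S, ih]; ring
theorem S_insR (w M : ℤ) (g : ℤ → ℤ → ℝ) (hz : ∀ j t, inR w M j t = false → g j t = 0)
    (c : ℝ) (e : Term) (r : List Term) :
    S g c (insR w M e r) = ev e.2.2 c * g e.1 e.2.1 + S g c r := by
  unfold insR
  cases h : inR w M e.1 e.2.1 with
  | true => exact S_ins g c e r
  | false => simp [hz _ _ h]
theorem S_zero (g : ℤ → ℤ → ℝ) (c : ℝ) (r : List Term) (h : ∀ e ∈ r, e.2.2 = []) : S g c r = 0 := by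
  induction r with
  | nil => rfl
  | cons e r ih =>
    rw [S, h e (by simp), ih fun e he => h e (by simp [he])]; simp [ev]
theorem zeroRow_nil (w M : ℤ) : ∀ e ∈ zeroRow w M, e.2.2 = [] := by
  intro e he
  simp only [zeroRow, List.mem_flatMap] at he
  obtain ⟨j, _, t, _, h⟩ := he
  split at h
  · simp at h; simp [h]
  · simp at h
noncomputable def cc (x : ℝ) : ℝ := (x + 1) / (x - 1)
theorem cc_der (x : ℝ) (hx : 1 < x) : HasDerivAt cc (-2 / (x - 1) ^ 2) x := by
  have h : x - 1 ≠ 0 := by linarith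
  have := ((hasDerivAt_id x).add_const (1:ℝ)).div ((hasDerivAt_id x).sub_const (1:ℝ)) h
  refine this.congr_deriv ?_
  simp only [id]; ring
structure Sys (w M : ℤ) (g : ℤ → ℤ → ℝ → ℝ) : Prop where
  hz : ∀ j t, inR w M j t = false → ∀ x > 1, g j t x = 0
  hg : ∀ j t, j ≤ M → ∀ x > 1, ∃ d, HasDerivAt (g j t) d x ∧
    (cc x + 1) ^ 2 * ((x ^ 2 - 1) * d) =
      -((w - j - 2 * t) * (cc x + 1) ^ 2 + 6 * j * (cc x + 1)) * g j t x
      + 2 * (w - j - 2 * t + 2) * cc x * (cc x + 1) ^ 2 * g j (t - 1) x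
      - (M - j + 1) * (cc x + 1) ^ 2 * g (j - 1) t x
      - 12 * (j + 1) * cc x * g (j + 1) t x
variable {w M : ℤ} {g : ℤ → ℤ → ℝ → ℝ}
theorem S_step (hs : Sys w M g) (z : List Term) (hzz : ∀ e ∈ z, e.2.2 = []) (r : List Term)
    (hr : ∀ e ∈ r, e.1 ≤ M) (x : ℝ) (hx : 1 < x) :
    ∃ d, HasDerivAt (fun x => S (fun j t => g j t x) (cc x) r) d x ∧
      (cc x + 1) ^ 2 * ((x ^ 2 - 1) * d) = S (fun j t => g j t x) (cc x) (step w M z r) := by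
  have hz' : ∀ j t, inR w M j t = false → (fun j t => g j t x) j t = 0 := fun j t h => hs.hz j t h x hx
  induction r with
  | nil =>
    refine ⟨0, by simpa [S] using hasDerivAt_const x (0:ℝ), ?_⟩
    rw [step, S_zero _ _ _ hzz]; simp
  | cons e r ih =>
    obtain ⟨d, hd, hd2⟩ := ih fun e he => hr e (by simp [he])
    obtain ⟨d', hd', hd2'⟩ := hs.hg e.1 e.2.1 (hr e (by simp)) x hx
    have h1 := ((ev_der e.2.2 (cc x)).comp x (cc_der x hx)).mul hd'
    refine ⟨_, h1.add hd, ?_⟩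
    simp only [step, step1, S_insR w M _ hz', ev_padd, ev_psc, ev_pX, ev_psq, ← hd2]
    have hc : (x ^ 2 - 1) * (-2 / (x - 1) ^ 2) = - 2 * cc x := by
      have h : x - 1 ≠ 0 := by linarith
      unfold cc; field_simp; ring
    simp only [Function.comp]
    push_cast
    linear_combination ev e.2.2 (cc x) * hd2' + (cc x + 1) ^ 2 * ev (pder e.2.2) (cc x) * g e.1 e.2.1 x * hc
theorem ins_keys (P : ℤ → ℤ → Prop) (e : Term) (r : List Term) (he : P e.1 e.2.1)
    (hr : ∀ e ∈ r, P e.1 e.2.1) : ∀ f ∈ ins e r, P f.1 f.2.1 := by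
  induction r with
  | nil => simpa [ins] using he
  | cons f r ih =>
    simp only [ins]
    have h2 := hr f (by simp)
    have h3 := ih fun e he => hr e (by simp [he])
    split_ifs with h
    · intro f' hf'
      rcases List.mem_cons.1 hf' with rfl | hf'
      · exact h2
      · exact hr _ (by simp [hf'])
    · intro f' hf'
      rcases List.mem_cons.1 hf' with rfl | hf'
      · exact h2
      · exact h3 _ hf'
theorem insR_keys (e : Term) (r : List Term) 
    (hr : ∀ e ∈ r, inR w M e.1 e.2.1 = true) : ∀ f ∈ insR w M e r, inR w M f.1 f.2.1 = true := by
  unfold insR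
  cases h : inR w M e.1 e.2.1 with
  | true => exact ins_keys (fun a b => inR w M a b = true) e r h hr
  | false => exact hr
theorem zeroRow_keys : ∀ e ∈ zeroRow w M, inR w M e.1 e.2.1 = true := by
  intro e he
  simp only [zeroRow, List.mem_flatMap] at he
  obtain ⟨j, _, t, _, h⟩ := he
  split at h
  · simp at h; simp [h]; assumption
  · simp at h
theorem step_keys (z : List Term) (hz : ∀ e ∈ z, inR w M e.1 e.2.1 = true) (r : List Term) :
    ∀ f ∈ step w M z r, inR w M f.1 f.2.1 = true := by
  induction r with
  | nil => exact hz
  | cons e r ih => exact insR_keys _ _ (insR_keys _ _ (insR_keys _ _ (insR_keys _ _ ih)))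
theorem inR_le {j t : ℤ} (h : inR w M j t = true) : j ≤ M := by
  simp [inR] at h; omega
theorem iter_zero (hs : Sys w M g) (n : ℕ) (r : List Term)
    (hk : ∀ e ∈ r, inR w M e.1 e.2.1 = true)
    (h : ∀ x > 1, S (fun j t => g j t x) (cc x) r = 0) :
    ∀ r' ∈ iter w M n r, ∀ x > 1, S (fun j t => g j t x) (cc x) r' = 0 := by
  induction n generalizing r with
  | zero => simp [iter]
  | succ n ih =>
    intro r' hr'
    rcases List.mem_cons.1 hr' with rfl | hr'
    · exact h
    · refine ih _ (step_keys _ zeroRow_keys _) ?_ r' hr'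
      intro x hx
      obtain ⟨d, hd, hd2⟩ := S_step hs (zeroRow w M) (zeroRow_nil w M) r
        (fun e he => inR_le (hk e he)) x hx
      have : d = 0 := by
        refine hd.unique ((hasDerivAt_const x (0:ℝ)).congr_of_eventuallyEq ?_)
        filter_upwards [Ioi_mem_nhds hx] with y hy using h y hy
      rw [← hd2, this]; ring
def dot (r : List ℤ) (g : List ℝ) : ℝ := match r, g with
  | [], _ => 0
  | _, [] => 0
  | a :: r, b :: g => a * b + dot r g
theorem dot_padd (r s : List ℤ) (g : List ℝ) : dot (padd r s) g = dot r g + dot s g := by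
  induction g generalizing r s with
  | nil => cases r <;> cases s <;> simp [dot, padd]
  | cons b g ih => cases r <;> cases s <;> simp [dot, padd, ih]; ring
theorem dot_psc (k : ℤ) (r : List ℤ) (g : List ℝ) : dot (psc k r) g = k * dot r g := by
  induction g generalizing r with
  | nil => cases r <;> simp [dot, psc]
  | cons b g ih => cases r <;> simp [dot, psc, ih]; ring
theorem red_zero (p0 : ℤ) (p : List ℤ) (r : List ℤ) (b : ℝ) (g : List ℝ)
    (hp : dot (p0 :: p) (b :: g) = 0) (hr : dot r (b :: g) = 0) : dot (red p0 p r) g = 0 := by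
  cases r with
  | nil => simp [red, dot]
  | cons r0 r =>
    have h1 : dot (padd (psc p0 r) (psc (-r0) p)) g = 0 := by
      simp only [dot] at hp hr
      rw [dot_padd, dot_psc, dot_psc]; push_cast
      linear_combination (p0:ℝ) * hr - (r0:ℝ) * hp
    simp only [red]
    split_ifs with h
    · have h2 := h1
      rw [← h.1, dot_psc] at h2
      exact (mul_eq_zero.1 h2).resolve_left (by exact_mod_cast h.2)
    · exact h1
theorem findp_mem (rows : List (List ℤ)) (a : ℤ) (l : List ℤ) (h : findp rows = some (a, l)) :
    (a :: l) ∈ rows ∧ a ≠ 0 := by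
  induction rows with
  | nil => simp [findp] at h
  | cons r rs ih =>
    cases r with
    | nil => simp only [findp] at h; simp [ih h]
    | cons b r =>
      simp only [findp] at h
      split_ifs at h with hb
      · simp only [Option.some.injEq, Prod.mk.injEq] at h
        obtain ⟨rfl, rfl⟩ := h
        exact ⟨by simp, hb⟩
      · have := ih h
        exact ⟨by simp [this.1], this.2⟩
theorem elim_zero (n : ℕ) (rows : List (List ℤ)) (g : List ℝ) (hl : g.length = n)
    (h : elim n rows = true) (hr : ∀ r ∈ rows, dot r g = 0) : ∀ b ∈ g, b = 0 := by
  induction n generalizing rows g with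
  | zero => simp [List.length_eq_zero_iff.1 hl]
  | succ n ih =>
    cases g with
    | nil => simp
    | cons b g =>
      simp only [elim] at h
      split at h
      · simp at h
      · rename_i a l hf
        obtain ⟨hmem, ha⟩ := findp_mem _ _ _ hf
        have hp := hr _ hmem
        have hg := ih _ g (by simpa using hl) h (by
          intro r hr'
          obtain ⟨r', hr2, rfl⟩ := List.mem_map.1 hr'
          exact red_zero a l r' b g hp (hr r' hr2))
        have hd : ∀ (l : List ℤ) (g : List ℝ), (∀ b ∈ g, b = 0) → dot l g = 0 := by
          intro l g hg
          induction g generalizing l with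
          | nil => cases l <;> simp [dot]
          | cons b g ih =>
            cases l with
            | nil => simp [dot]
            | cons c l =>
              rw [dot, ih l (fun b hb => hg b (by simp [hb])), hg b (by simp)]; simp
        intro b' hb'
        rcases List.mem_cons.1 hb' with rfl | hb'
        · simp only [dot, hd l g hg, add_zero] at hp
          exact (mul_eq_zero.1 hp).resolve_left (by exact_mod_cast ha)
        · exact hg b' hb'
def keys (r : List Term) : List (ℤ × ℤ) := r.map fun e => (e.1, e.2.1)
theorem ins_keysEq (e : Term) (r : List Term) (h : (e.1, e.2.1) ∈ keys r) : keys (ins e r) = keys r := by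
  induction r with
  | nil => simp [keys] at h
  | cons f r ih =>
    simp only [ins]
    split_ifs with hh
    · simp [keys]
    · simp only [keys, List.map_cons, List.mem_cons, Prod.mk.injEq, hh, false_or] at h ⊢
      rw [List.cons.injEq]; exact ⟨rfl, ih h⟩
theorem zeroRow_mem (hM : M ≤ 6) (hw : w ≤ 7) (j t : ℤ) (h : inR w M j t = true) : (j, t) ∈ keys (zeroRow w M) := by
  have h' := h
  simp only [inR, Bool.and_eq_true, decide_eq_true_eq] at h'
  simp only [keys, zeroRow, List.mem_map, List.mem_flatMap]
  refine ⟨(j, t, []), ⟨j, ?_, t, ?_, ?_⟩, rfl⟩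
  · have : 0 ≤ j ∧ j ≤ 6 := by omega
    obtain ⟨h1, h2⟩ := this
    interval_cases j <;> simp
  · have : 0 ≤ t ∧ t ≤ 3 := by omega
    obtain ⟨h1, h2⟩ := this
    interval_cases t <;> simp
  · rw [h]; simp
theorem insR_keysEq (hM : M ≤ 6) (hw : w ≤ 7) (e : Term) (r : List Term) (h : keys r = keys (zeroRow w M)) :
    keys (insR w M e r) = keys (zeroRow w M) := by
  unfold insR
  cases hh : inR w M e.1 e.2.1 with
  | true =>
    rw [← h]; apply ins_keysEq; rw [h]; exact zeroRow_mem hM hw _ _ hh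
  | false => exact h
theorem step_keysEq (hM : M ≤ 6) (hw : w ≤ 7) (r : List Term) :
    keys (step w M (zeroRow w M) r) = keys (zeroRow w M) := by
  induction r with
  | nil => rfl
  | cons e r ih =>
    exact insR_keysEq hM hw _ _ (insR_keysEq hM hw _ _ (insR_keysEq hM hw _ _ (insR_keysEq hM hw _ _ ih)))
theorem iter_keysEq (hM : M ≤ 6) (hw : w ≤ 7) (n : ℕ) (r : List Term) (h : keys r = keys (zeroRow w M)) :
    ∀ r' ∈ iter w M n r, keys r' = keys (zeroRow w M) := by
  induction n generalizing r with
  | zero => simp [iter]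
  | succ n ih =>
    intro r' hr'
    rcases List.mem_cons.1 hr' with rfl | hr'
    · exact h
    · exact ih _ (step_keysEq hM hw r) r' hr'
theorem S_dot (g : ℤ → ℤ → ℝ) (r : List Term) :
    dot (vec r) ((keys r).map fun a => g a.1 a.2) = S g 2 r := by
  induction r with
  | nil => simp [vec, keys, dot, S]
  | cons e r ih =>
    simp only [vec, keys, List.map_cons, dot, S] at ih ⊢
    rw [ih, ← ev_pev]; norm_num
theorem nve_pt (hs : Sys w M g) (hM : M ≤ 6) (hw : w ≤ 7) (n : ℕ) (h : chk w M n = true) (j t : ℤ) :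
    g j t 3 = 0 := by
  by_cases hin : inR w M j t = true
  swap
  · exact hs.hz j t (by simpa using hin) 3 (by norm_num)
  have hz' : ∀ x > 1, ∀ j t, inR w M j t = false → (fun j t => g j t x) j t = 0 := fun x hx j t h => hs.hz j t h x hx
  have h0 : ∀ t : ℤ, w + 1 - 2 * t ≤ M → ∀ x > 1, S (fun j t => g j t x) (cc x) (row0 w M t) = 0 := by
    intro t ht x hx
    simp only [row0, S_insR w M _ (hz' x hx), S_zero _ _ _ (zeroRow_nil w M), ev]
    obtain ⟨d, hd, hd2⟩ := hs.hg (w + 1 - 2 * t) t ht x hx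
    have e1 : ∀ x > 1, g (w + 1 - 2 * t) t x = 0 := hs.hz _ _ (by simp [inR])
    have e2 : ∀ x > 1, g (w + 1 - 2 * t + 1) t x = 0 := hs.hz _ _ (by
      have : ¬ (w + 1 - 2 * t + 1 + 2 * t ≤ w) := by omega
      simp only [inR, this, decide_false, Bool.and_false])
    have hd0 : d = 0 := by
      refine hd.unique ((hasDerivAt_const x (0:ℝ)).congr_of_eventuallyEq ?_)
      filter_upwards [Ioi_mem_nhds hx] with y hy using e1 y hy
    have hc : cc x + 1 ≠ 0 := by
      have : 0 < cc x := div_pos (by linarith) (by linarith)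
      linarith
    rw [e1 x hx, e2 x hx, hd0, show w + 1 - 2 * t - 1 = w - 2 * t by ring] at hd2
    have h3 : (cc x + 1) ^ 2 ≠ 0 := pow_ne_zero _ hc
    apply mul_left_cancel₀ h3
    push_cast at hd2 ⊢
    linear_combination -hd2
  have hk0 : ∀ t, keys (row0 w M t) = keys (zeroRow w M) := fun t =>
    insR_keysEq hM hw _ _ (insR_keysEq hM hw _ _ rfl)
  have hmain := elim_zero _ (allRows w M n) ((keys (zeroRow w M)).map fun a => g a.1 a.2 3)
    (by simp [keys]) h (by
      intro r hr
      simp only [allRows, List.mem_map, List.mem_flatMap] at hr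
      obtain ⟨r, ⟨t, _, hr⟩, rfl⟩ := hr
      split_ifs at hr with ht
      · rw [← iter_keysEq hM hw n _ (hk0 t) r hr, S_dot (fun j t => g j t 3)]
        have := iter_zero hs n (row0 w M t) (insR_keys _ _ (insR_keys _ _ zeroRow_keys)) (h0 t ht) r hr 3 (by norm_num)
        rwa [show cc 3 = 2 by norm_num [cc]] at this
      · simp at hr)
  exact hmain _ (List.mem_map.2 ⟨(j, t), zeroRow_mem hM hw j t hin, rfl⟩)
theorem nve (hs : Sys w M g) (hM : M ≤ 6) (hw : w ≤ 7) (n : ℕ) (h : chk w M n = true) (j t : ℤ) :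
    ∀ x > 1, g j t x = 0 := by
  by_cases hin : inR w M j t = true
  swap
  · exact hs.hz j t (by simpa using hin)
  let T : Finset (ℤ × ℤ) := Finset.Icc 0 6 ×ˢ Finset.Icc 0 3
  have hT : ∀ a : ℤ × ℤ, inR w M a.1 a.2 = true → a ∈ T := by
    intro a ha
    simp only [inR, Bool.and_eq_true, decide_eq_true_eq] at ha
    simp only [T, Finset.mem_product, Finset.mem_Icc]; omega
  let U : Finset (ℤ × ℤ) := T.filter fun a => inR w M a.1 a.2 = true
  have hU : ∀ a : ℤ × ℤ, a ∈ U ↔ inR w M a.1 a.2 = true := by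
    intro a; simp only [U, Finset.mem_filter]; exact ⟨fun h => h.2, fun h => ⟨hT a h, h⟩⟩
  let m : U → U → ℝ → ℝ := fun a b x =>
    (if b.1 = a.1 then -((w - a.1.1 - 2 * a.1.2) * (cc x + 1) ^ 2 + 6 * a.1.1 * (cc x + 1)) / ((cc x + 1) ^ 2 * (x ^ 2 - 1)) else 0)
    + (if b.1 = (a.1.1, a.1.2 - 1) then 2 * (w - a.1.1 - 2 * a.1.2 + 2) * cc x * (cc x + 1) ^ 2 / ((cc x + 1) ^ 2 * (x ^ 2 - 1)) else 0)
    + (if b.1 = (a.1.1 - 1, a.1.2) then -(M - a.1.1 + 1) * (cc x + 1) ^ 2 / ((cc x + 1) ^ 2 * (x ^ 2 - 1)) else 0)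
    + (if b.1 = (a.1.1 + 1, a.1.2) then -12 * (a.1.1 + 1) * cc x / ((cc x + 1) ^ 2 * (x ^ 2 - 1)) else 0)
  have hcc : ContinuousOn cc (Set.Ioi 1) := fun x hx => (cc_der x hx).continuousAt.continuousWithinAt
  have hden : ∀ x > 1, (cc x + 1) ^ 2 * (x ^ 2 - 1) ≠ 0 := by
    intro x hx
    have h1 : 0 < cc x := div_pos (by linarith) (by linarith)
    have h2 : 0 < x ^ 2 - 1 := by nlinarith
    positivity
  have hmc : ∀ a b, ContinuousOn (m a b) (Set.Ioi 1) := by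
    intro a b
    have hd : ContinuousOn (fun x => (cc x + 1) ^ 2 * (x ^ 2 - 1)) (Set.Ioi 1) := by fun_prop
    have hite : ∀ (p : Prop) [Decidable p] (f : ℝ → ℝ), ContinuousOn f (Set.Ioi 1) →
        ContinuousOn (fun x => if p then f x / ((cc x + 1) ^ 2 * (x ^ 2 - 1)) else 0) (Set.Ioi 1) := by
      intro p _ f hf
      by_cases hp : p
      · simp only [hp, if_true]; exact hf.div hd hden
      · simp only [hp, if_false]; exact continuousOn_const
    refine (((hite _ _ ?_).add (hite _ _ ?_)).add (hite _ _ ?_)).add (hite _ _ ?_) <;> fun_prop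
  have hsum : ∀ (x : ℝ), 1 < x → ∀ (q : ℤ × ℤ) (f : ℝ), ∑ b : U, (if b.1 = q then f else 0) * g b.1.1 b.1.2 x = f * g q.1 q.2 x := by
    intro x hx q f
    rw [Finset.sum_coe_sort U (fun b => (if b = q then f else 0) * g b.1 b.2 x)]
    simp only [ite_mul, zero_mul]
    rw [Finset.sum_ite_eq' U q (fun b => f * g b.1 b.2 x)]
    split_ifs with hq
    · rfl
    · rw [hs.hz q.1 q.2 (by rw [hU] at hq; simpa using hq) x hx, mul_zero]
  have := lin_ode (ι := U) (fun a => g a.1.1 a.1.2) m hmc (by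
    intro a x hx
    obtain ⟨d, hd, hd2⟩ := hs.hg a.1.1 a.1.2 (inR_le ((hU a.1).1 a.2)) x hx
    convert hd using 1
    simp only [m, add_mul, Finset.sum_add_distrib]
    rw [hsum x hx, hsum x hx, hsum x hx, hsum x hx]
    have hh := hden x hx
    apply mul_left_cancel₀ hh
    rw [mul_assoc _ _ d, hd2]
    generalize (cc x + 1) ^ 2 * (x ^ 2 - 1) = D at hh
    field_simp
    ring) 3 (by norm_num) (fun a => nve_pt hs hM hw n h _ _)
  exact this ⟨(j, t), (hU _).2 hin⟩
end NV

set_option maxRecDepth 100000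
namespace NV
theorem chk51 : chk 5 1 6 = true := by decide +kernel
theorem chk52 : chk 5 2 4 = true := by decide +kernel
theorem chk53 : chk 5 3 5 = true := by decide +kernel
theorem chk54 : chk 5 4 4 = true := by decide +kernel
theorem chk55 : chk 5 5 4 = true := by decide +kernel
theorem chk56 : chk 5 6 3 = true := by decide +kernel
theorem chk61 : chk 6 1 7 = true := by decide +kernel
theorem chk62 : chk 6 2 10 = true := by decide +kernel
theorem chk63 : chk 6 3 6 = true := by decide +kernel
theorem chk64 : chk 6 4 7 = true := by decide +kernel
theorem chk65 : chk 6 5 5 = true := by decide +kernel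
theorem chk66 : chk 6 6 6 = true := by decide +kernel
theorem chk_all (w M : ℤ) (hw : w = 5 ∨ w = 6) (h1 : 1 ≤ M) (h6 : M ≤ 6) : ∃ n, chk w M n = true := by
  have : M = 1 ∨ M = 2 ∨ M = 3 ∨ M = 4 ∨ M = 5 ∨ M = 6 := by omega
  rcases hw with rfl | rfl <;> rcases this with rfl | rfl | rfl | rfl | rfl | rfl
  exacts [⟨_, chk51⟩, ⟨_, chk52⟩, ⟨_, chk53⟩, ⟨_, chk54⟩, ⟨_, chk55⟩, ⟨_, chk56⟩,
    ⟨_, chk61⟩, ⟨_, chk62⟩, ⟨_, chk63⟩, ⟨_, chk64⟩, ⟨_, chk65⟩, ⟨_, chk66⟩]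
end NV

/-! ### The ring of smooth functions on the two-dimensional base -/
namespace ZV
open scoped ContDiff
def Om : Set (ℝ × ℝ) := {z | 1 < z.1 ∧ -1 < z.2 ∧ z.2 < 1}
theorem isOpen_Om : IsOpen Om := by
  refine (isOpen_lt continuous_const continuous_fst).inter
    ((isOpen_lt continuous_const continuous_snd).inter (isOpen_lt continuous_snd continuous_const))
open Classical in
def ex (f : Om → ℝ) (z : ℝ × ℝ) : ℝ := if h : z ∈ Om then f ⟨z, h⟩ else 0
theorem ex_of (f : Om → ℝ) (z : Om) : ex f z = f z := by simp [ex]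
theorem ex_mem (f : Om → ℝ) {z : ℝ × ℝ} (h : z ∈ Om) : ex f z = f ⟨z, h⟩ := by simp [ex, h]
/-- smooth functions on `Om` -/
def SA : Subalgebra ℝ (Om → ℝ) where
  carrier := {f | ContDiffOn ℝ ∞ (ex f) Om}
  mul_mem' {f g} hf hg := by
    refine (ContDiffOn.mul hf hg).congr fun z hz => ?_
    simp [ex_mem _ hz]
  add_mem' {f g} hf hg := by
    refine (ContDiffOn.add hf hg).congr fun z hz => ?_
    simp [ex_mem _ hz]
  algebraMap_mem' r := by
    refine (contDiffOn_const (c := r)).congr fun z hz => ?_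
    simp [ex_mem _ hz]
abbrev Sm := SA
def exS (f : Sm) : ℝ × ℝ → ℝ := ex f.1
theorem exS_smooth (f : Sm) : ContDiffOn ℝ ∞ (exS f) Om := f.2
theorem exS_smoothAt (f : Sm) (z : Om) : ContDiffAt ℝ ∞ (exS f) z :=
  (f.2).contDiffAt (isOpen_Om.mem_nhds z.2)
theorem exS_diff (f : Sm) (z : Om) : DifferentiableAt ℝ (exS f) z :=
  (exS_smoothAt f z).differentiableAt (by simp)
/-- evaluation -/
def evp (z : Om) : Sm →ₐ[ℝ] ℝ := (Pi.evalAlgHom ℝ (fun _ : Om => ℝ) z).comp SA.val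
theorem exS_of (f : Sm) (z : Om) : exS f z = evp z f := ex_of _ _
theorem exS_mem (f : Sm) {z : ℝ × ℝ} (h : z ∈ Om) : exS f z = evp ⟨z, h⟩ f := ex_mem _ h
theorem Sm_ext {f g : Sm} (h : ∀ z, evp z f = evp z g) : f = g := Subtype.ext (funext h)
def mkS (F : ℝ × ℝ → ℝ) (h : ContDiffOn ℝ ∞ F Om) : Sm :=
  ⟨fun z => F z, h.congr fun z hz => by simp [ex_mem _ hz]⟩
@[simp] theorem evp_mkS (F) (h : ContDiffOn ℝ ∞ F Om) (z : Om) : evp z (mkS F h) = F z := rfl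
theorem exS_mkS (F) (h : ContDiffOn ℝ ∞ F Om) (z : Om) : exS (mkS F h) =ᶠ[nhds z.1] F := by
  filter_upwards [isOpen_Om.mem_nhds z.2] with y hy
  rw [exS_mem _ hy]; rfl
theorem exS_ev_eq {f : Sm} {F : ℝ × ℝ → ℝ} (h : ∀ z : Om, evp z f = F z) (z : Om) :
    exS f =ᶠ[nhds z.1] F := by
  filter_upwards [isOpen_Om.mem_nhds z.2] with y hy
  rw [exS_mem _ hy]; exact h _
def dv (v : ℝ × ℝ) : Derivation ℝ Sm Sm where
  toFun f := mkS (fun z => fderiv ℝ (exS f) z v) (by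
    have := (exS_smooth f).fderiv_of_isOpen (m := ∞) isOpen_Om (by simp)
    exact this.clm_apply contDiffOn_const)
  map_add' f g := by
    apply Sm_ext; intro z
    simp only [evp_mkS, map_add]
    have : exS (f + g) =ᶠ[nhds z.1] (exS f + exS g) := exS_ev_eq (fun z => by simp [exS_of]) z
    rw [this.fderiv_eq, fderiv_add (exS_diff f z) (exS_diff g z)]; rfl
  map_smul' r f := by
    apply Sm_ext; intro z
    simp only [evp_mkS, map_smul, RingHom.id_apply]
    have : exS (r • f) =ᶠ[nhds z.1] (r • exS f) := exS_ev_eq (fun z => by simp [exS_of]) z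
    rw [this.fderiv_eq, fderiv_const_smul (exS_diff f z)]; rfl
  map_one_eq_zero' := by
    apply Sm_ext; intro z
    change fderiv ℝ (exS 1) z v = evp z 0
    have : exS 1 =ᶠ[nhds z.1] (fun _ => (1:ℝ)) := exS_ev_eq (fun z => by simp) z
    rw [this.fderiv_eq]; simp
  leibniz' f g := by
    apply Sm_ext; intro z
    change fderiv ℝ (exS (f * g)) z v = evp z (_ • _ + _ • _)
    have : exS (f * g) =ᶠ[nhds z.1] (exS f * exS g) := exS_ev_eq (fun z => by simp [exS_of]) z
    rw [this.fderiv_eq, fderiv_mul (exS_diff f z) (exS_diff g z)]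
    simp only [smul_eq_mul, map_add, map_mul, exS_of]; rfl
def dx := dv (1, 0)
def dy := dv (0, 1)
theorem evp_dv (v : ℝ × ℝ) (f : Sm) (z : Om) : evp z (dv v f) = fderiv ℝ (exS f) z v := rfl
theorem dv_comm (v w : ℝ × ℝ) (f : Sm) : dv v (dv w f) = dv w (dv v f) := by
  apply Sm_ext; intro z
  rw [evp_dv, evp_dv]
  have h : ∀ v w : ℝ × ℝ, fderiv ℝ (exS (dv w f)) z v = fderiv ℝ (fderiv ℝ (exS f)) z v w := by
    intro v w
    have e : exS (dv w f) =ᶠ[nhds z.1] (fun z => fderiv ℝ (exS f) z w) := exS_ev_eq (fun z => evp_dv w f z) z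
    rw [e.fderiv_eq]
    have hd : DifferentiableAt ℝ (fderiv ℝ (exS f)) z :=
      ((exS_smoothAt f z).fderiv_right (m := 1) (by norm_cast)).differentiableAt (by simp)
    rw [fderiv_clm_apply hd (by fun_prop)]
    simp
  rw [h, h]
  exact ((exS_smoothAt f z).isSymmSndFDerivAt (by simp; norm_cast)).eq _ _
theorem dxy (f : Sm) : dx (dy f) = dy (dx f) := dv_comm _ _ f
theorem exS_hasFDeriv (f : Sm) (z : Om) : HasFDerivAt (exS f)
    (evp z (dx f) • ContinuousLinearMap.fst ℝ ℝ ℝ + evp z (dy f) • ContinuousLinearMap.snd ℝ ℝ ℝ) z.1 := by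
  refine (exS_diff f z).hasFDerivAt.congr_fderiv ?_
  apply ContinuousLinearMap.ext
  rintro ⟨a, b⟩
  have : ((a, b) : ℝ × ℝ) = a • (1, 0) + b • (0, 1) := by simp
  rw [this, map_add, map_smul, map_smul]
  simp [dx, dy, evp_dv, mul_comm]
/-- points on the line `y = 0` -/
def pt (x : ℝ) (hx : 1 < x) : Om := ⟨(x, 0), hx, by norm_num, by norm_num⟩
theorem line_deriv (f : Sm) (x : ℝ) (hx : 1 < x) :
    HasDerivAt (fun x => exS f (x, 0)) (evp (pt x hx) (dx f)) x := by
  have h := (exS_hasFDeriv f (pt x hx))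
  have h2 : HasDerivAt (fun x : ℝ => ((x, 0) : ℝ × ℝ)) (1, 0) x :=
    (hasDerivAt_id x).prodMk (hasDerivAt_const x 0)
  have := h.comp_hasDerivAt (f := fun x : ℝ => ((x, 0) : ℝ × ℝ)) x h2
  refine HasDerivAt.congr_deriv (f := fun x => exS f (x, 0)) this ?_
  simp
theorem exS_pt (f : Sm) (x : ℝ) (hx : 1 < x) : exS f (x, 0) = evp (pt x hx) f := exS_of f (pt x hx)

/-! generators -/
def sX : Sm := mkS (fun z => z.1) contDiffOn_fst
def sY : Sm := mkS (fun z => z.2) contDiffOn_snd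
def sE : Sm := mkS (fun z => (z.1 + 1)⁻¹) ((contDiffOn_fst.add contDiffOn_const).inv fun z hz => by
  have := hz.1; simp; linarith)
def sF : Sm := mkS (fun z => (z.1 - 1)⁻¹) ((contDiffOn_fst.sub contDiffOn_const).inv fun z hz => by
  have := hz.1; simp; linarith)
theorem om1 {z : ℝ × ℝ} (hz : z ∈ Om) : 0 < 1 - z.2 ^ 2 := by
  have := hz.2.1; have := hz.2.2; nlinarith
theorem om2 {z : ℝ × ℝ} (hz : z ∈ Om) : 0 < z.1 ^ 2 - z.2 ^ 2 := by
  have := hz.1; have := om1 hz; nlinarith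
def sB : Sm := mkS (fun z => (1 - z.2 ^ 2)⁻¹) ((contDiffOn_const.sub (contDiffOn_snd.pow 2)).inv fun _ hz =>
  (om1 hz).ne')
def sS : Sm := mkS (fun z => (z.1 ^ 2 - z.2 ^ 2)⁻¹) (((contDiffOn_fst.pow 2).sub (contDiffOn_snd.pow 2)).inv fun _ hz =>
  (om2 hz).ne')
theorem sE_mul : sE * (sX + 1) = 1 := by
  apply Sm_ext; intro z
  have := z.2.1
  simp only [map_mul, map_add, map_one, sE, sX, evp_mkS]
  exact inv_mul_cancel₀ (by linarith)
theorem sF_mul : sF * (sX - 1) = 1 := by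
  apply Sm_ext; intro z
  have := z.2.1
  simp only [map_mul, map_sub, map_one, sF, sX, evp_mkS]
  exact inv_mul_cancel₀ (by linarith)
theorem sB_mul : sB * (1 - sY ^ 2) = 1 := by
  apply Sm_ext; intro z
  simp only [map_mul, map_sub, map_one, map_pow, sB, sY, evp_mkS]
  exact inv_mul_cancel₀ (om1 z.2).ne'
theorem sS_mul : sS * (sX ^ 2 - sY ^ 2) = 1 := by
  apply Sm_ext; intro z
  simp only [map_mul, map_sub, map_pow, map_one, sS, sX, sY, evp_mkS]
  exact inv_mul_cancel₀ (om2 z.2).ne'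
theorem dv_sX (v : ℝ × ℝ) : dv v sX = algebraMap ℝ Sm v.1 := by
  apply Sm_ext; intro z
  rw [evp_dv, (exS_ev_eq (F := fun z => z.1) (fun z => rfl) z).fderiv_eq, AlgHom.commutes]
  simp [fderiv_fst]
theorem dv_sY (v : ℝ × ℝ) : dv v sY = algebraMap ℝ Sm v.2 := by
  apply Sm_ext; intro z
  rw [evp_dv, (exS_ev_eq (F := fun z => z.2) (fun z => rfl) z).fderiv_eq, AlgHom.commutes]
  simp [fderiv_snd]
@[simp] theorem dx_sX : dx sX = 1 := by simp [dx, dv_sX]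
@[simp] theorem dy_sX : dy sX = 0 := by simp [dy, dv_sX]
@[simp] theorem dx_sY : dx sY = 0 := by simp [dx, dv_sY]
@[simp] theorem dy_sY : dy sY = 1 := by simp [dy, dv_sY]
theorem d_inv (D : Derivation ℝ Sm Sm) (a b : Sm) (h : a * b = 1) : D a = - a ^ 2 * D b := by
  have h1 := congrArg D h
  rw [D.leibniz, D.map_one_eq_zero, smul_eq_mul, smul_eq_mul] at h1
  linear_combination a * h1 - D a * h
@[simp] theorem d_num (D : Derivation ℝ Sm Sm) (n : ℕ) [n.AtLeastTwo] : D (OfNat.ofNat n : Sm) = 0 :=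
  D.map_natCast n
@[simp] theorem dx_sE : dx sE = - sE ^ 2 := by rw [d_inv dx _ _ sE_mul]; simp
@[simp] theorem dy_sE : dy sE = 0 := by rw [d_inv dy _ _ sE_mul]; simp
@[simp] theorem dx_sF : dx sF = - sF ^ 2 := by rw [d_inv dx _ _ sF_mul]; simp
@[simp] theorem dy_sF : dy sF = 0 := by rw [d_inv dy _ _ sF_mul]; simp
@[simp] theorem dx_sB : dx sB = 0 := by rw [d_inv dx _ _ sB_mul]; simp [Derivation.leibniz_pow]
@[simp] theorem dy_sB : dy sB = 2 * sY * sB ^ 2 := by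
  rw [d_inv dy _ _ sB_mul]; simp [Derivation.leibniz_pow]; ring
@[simp] theorem dx_sS : dx sS = - 2 * sX * sS ^ 2 := by
  rw [d_inv dx _ _ sS_mul]; simp [Derivation.leibniz_pow]; ring
@[simp] theorem dy_sS : dy sS = 2 * sY * sS ^ 2 := by
  rw [d_inv dy _ _ sS_mul]; simp [Derivation.leibniz_pow]; ring
end ZV

/-! ### Polynomials in the momenta -/
namespace ZV
open MvPolynomial
abbrev RP := MvPolynomial (Fin 4) Sm
def Dc (D : Derivation ℝ Sm Sm) (P : RP) : RP := ∑ m ∈ P.support, monomial m (D (coeff m P))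
theorem coeff_Dc (D : Derivation ℝ Sm Sm) (P : RP) (m : Fin 4 →₀ ℕ) :
    coeff m (Dc D P) = D (coeff m P) := by
  classical
  simp only [Dc, coeff_sum, coeff_monomial]
  rw [Finset.sum_ite_eq' P.support m]
  split_ifs with h
  · rfl
  · rw [MvPolynomial.notMem_support_iff.1 h, map_zero]
theorem Dc_C (D : Derivation ℝ Sm Sm) (a : Sm) : Dc D (C a) = C (D a) := by
  classical
  ext m
  rw [coeff_Dc, coeff_C, coeff_C]
  split_ifs <;> simp
theorem Dc_add (D : Derivation ℝ Sm Sm) (P Q : RP) : Dc D (P + Q) = Dc D P + Dc D Q := by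
  ext m; simp [coeff_Dc]
theorem Dc_mulX (D : Derivation ℝ Sm Sm) (P : RP) (n : Fin 4) : Dc D (P * X n) = Dc D P * X n := by
  classical
  ext m
  rw [coeff_Dc, coeff_mul_X', coeff_mul_X', coeff_Dc]
  split_ifs <;> simp
/-- evaluation at a base point and momenta -/
def evm (z : Om) (μ : Fin 4 → ℝ) : RP →+* ℝ := eval₂Hom (evp z : Sm →+* ℝ) μ
@[simp] theorem evm_C (z : Om) (μ) (a : Sm) : evm z μ (C a) = evp z a := by simp [evm]
@[simp] theorem evm_X (z : Om) (μ) (n : Fin 4) : evm z μ (X n) = μ n := by simp [evm]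
def mom (z : PhasePt) : Fin 4 → ℝ := fun n => z (Fin.natAdd 4 n)
def bs (z : PhasePt) : ℝ × ℝ := (z 0, z 1)
theorem bs_mem {z : PhasePt} (h : z ∈ TStar) : bs z ∈ Om := h
open Classical in
def rep (P : RP) (z : PhasePt) : ℝ := if h : bs z ∈ Om then evm ⟨bs z, h⟩ (mom z) P else 0
theorem rep_of (P : RP) {z : PhasePt} (h : z ∈ TStar) : rep P z = evm ⟨bs z, bs_mem h⟩ (mom z) P := by
  have := bs_mem h
  simp [rep, this]
theorem isOpen_TStar : IsOpen TStar := by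
  refine (isOpen_lt continuous_const (continuous_apply 0)).inter
    ((isOpen_lt continuous_const (continuous_apply 1)).inter (isOpen_lt (continuous_apply 1) continuous_const))
theorem rep_ev {P : RP} {F : PhasePt → ℝ} (h : ∀ z ∈ TStar, rep P z = F z) {z : PhasePt} (hz : z ∈ TStar) :
    rep P =ᶠ[nhds z] F := by
  filter_upwards [isOpen_TStar.mem_nhds hz] with y hy using h y hy
abbrev pj (i : Fin 8) : PhasePt →L[ℝ] ℝ := ContinuousLinearMap.proj i
theorem rep_fderiv (P : RP) {z : PhasePt} (hz : z ∈ TStar) :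
    HasFDerivAt (rep P) (rep (Dc dx P) z • pj 0 + rep (Dc dy P) z • pj 1
      + ∑ n, rep (pderiv n P) z • pj (Fin.natAdd 4 n)) z := by
  induction P using MvPolynomial.induction_on with
  | C a =>
    have e : rep (C a) =ᶠ[nhds z] (exS a ∘ bs) := rep_ev (fun z hz => by
      rw [rep_of _ hz, evm_C, Function.comp, exS_mem]) hz
    refine HasFDerivAt.congr_of_eventuallyEq ?_ e
    have h1 := exS_hasFDeriv a ⟨bs z, bs_mem hz⟩
    have h2 : HasFDerivAt bs ((pj 0).prod (pj 1)) z := (pj 0).hasFDerivAt.prodMk (pj 1).hasFDerivAt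
    refine (HasFDerivAt.comp z h1 h2).congr_fderiv ?_
    simp only [Dc_C, rep_of _ hz, evm_C, pderiv_C, map_zero, zero_smul, Finset.sum_const_zero, add_zero]
    ext v; simp
  | add p q hp hq =>
    have e : rep (p + q) =ᶠ[nhds z] (rep p + rep q) := rep_ev (fun z hz => by
      simp only [Pi.add_apply, rep_of _ hz, map_add]) hz
    refine HasFDerivAt.congr_of_eventuallyEq ?_ e
    refine (hp.add hq).congr_fderiv ?_
    simp only [Dc_add, map_add, rep_of _ hz, add_smul, Finset.sum_add_distrib]
    abel
  | mul_X p n hp =>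
    have e : rep (p * X n) =ᶠ[nhds z] (rep p * (fun z => pj (Fin.natAdd 4 n) z)) := rep_ev (fun z hz => by
      simp only [Pi.mul_apply, rep_of _ hz, map_mul, evm_X]; rfl) hz
    refine HasFDerivAt.congr_of_eventuallyEq ?_ e
    refine (hp.mul (pj (Fin.natAdd 4 n)).hasFDerivAt).congr_fderiv ?_
    have h1 : ∀ k, rep (pderiv k (p * X n)) z = rep p z * (if n = k then 1 else 0) + mom z n * rep (pderiv k p) z := by
      intro k
      simp only [Derivation.leibniz, smul_eq_mul, pderiv_X, rep_of _ hz, map_add, map_mul, evm_X, Pi.single_apply, apply_ite (evm _ _), map_one, map_zero]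
    have h2 : ∑ k, rep (pderiv k (p * X n)) z • pj (Fin.natAdd 4 k)
       = rep p z • pj (Fin.natAdd 4 n) + mom z n • ∑ k, rep (pderiv k p) z • pj (Fin.natAdd 4 k) := by
      simp only [h1, add_smul, Finset.sum_add_distrib, Finset.smul_sum, mul_smul]
      congr 1
      rw [Finset.sum_eq_single n]
      · simp
      · intro b _ hb; simp [hb.symm]
      · simp
    have h3 : mom z n = pj (Fin.natAdd 4 n) z := rfl
    have h4 : ∀ D, rep (Dc D (p * X n)) z = mom z n * rep (Dc D p) z := by
      intro D; simp only [Dc_mulX, rep_of _ hz, map_mul, evm_X]; ring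
    rw [h2, h4, h4, ← h3]
    simp only [smul_add, mul_smul]
    abel
theorem pd_rep (P : RP) {z : PhasePt} (hz : z ∈ TStar) :
    pd 0 (rep P) z = rep (Dc dx P) z ∧ pd 1 (rep P) z = rep (Dc dy P) z ∧
    pd 2 (rep P) z = 0 ∧ pd 3 (rep P) z = 0 ∧
    pd 4 (rep P) z = rep (pderiv 0 P) z ∧ pd 5 (rep P) z = rep (pderiv 1 P) z ∧
    pd 6 (rep P) z = rep (pderiv 2 P) z ∧ pd 7 (rep P) z = rep (pderiv 3 P) z := by
  simp only [pd, (rep_fderiv P hz).fderiv]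
  refine ⟨?_, ?_, ?_, ?_, ?_, ?_, ?_, ?_⟩ <;>
  simp [Fin.sum_univ_four, Pi.single_apply, Fin.ext_iff]
theorem RP_ext {P Q : RP} (h : ∀ z μ, evm z μ P = evm z μ Q) : P = Q := by
  refine MvPolynomial.ext _ _ fun m => ?_
  apply Sm_ext; intro z
  have : map (evp z : Sm →+* ℝ) P = map (evp z : Sm →+* ℝ) Q := by
    apply MvPolynomial.funext
    intro μ
    have := h z μ
    simpa [evm, eval_map] using this
  have := congrArg (coeff m) this
  simpa [coeff_map] using this
theorem RP_zero {P : RP} (h : ∀ z ∈ TStar, rep P z = 0) : P = 0 := by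
  apply RP_ext
  intro z μ
  rw [map_zero]
  have hz : (![z.1.1, z.1.2, 0, 0, μ 0, μ 1, μ 2, μ 3] : PhasePt) ∈ TStar := z.2
  have := h _ hz
  rw [rep_of _ hz] at this
  rw [← this]
  congr 2
  ext n; fin_cases n <;> rfl
/-! The Hamiltonian -/
def aA : Sm := (sX ^ 2 - sY ^ 2) ^ 3 * sE ^ 6 * sF ^ 2
def cst (r : ℝ) : Sm := algebraMap ℝ Sm r
@[simp] theorem evp_cst (z r) : evp z (cst r) = r := by simp [cst]
@[simp] theorem d_cst (D : Derivation ℝ Sm Sm) (r) : D (cst r) = 0 := D.map_algebraMap r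
def h0 : Sm := cst (1/2) * aA * (sX ^ 2 - 1)
def h1 : Sm := cst (1/2) * aA * (1 - sY ^ 2)
def h2 : Sm := cst (1/2) * ((sX - 1) * sE ^ 3 * sB)
def h3 : Sm := cst (-1/2) * ((sX + 1) ^ 2 * sF ^ 2)
def Hp : RP := C h0 * X 0 ^ 2 + C h1 * X 1 ^ 2 + C h2 * X 2 ^ 2 + C h3 * X 3 ^ 2
theorem rep_Hp {z : PhasePt} (hz : z ∈ TStar) : rep Hp z = Ham z := by
  rw [rep_of _ hz]
  have hx : z 0 - 1 ≠ 0 := by have := hz.1; linarith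
  have hx' : z 0 + 1 ≠ 0 := by have := hz.1; linarith
  have ho1 : 1 - z 1 ^ 2 ≠ 0 := (om1 (bs_mem hz)).ne'
  have ho2 : z 0 ^ 2 - z 1 ^ 2 ≠ 0 := (om2 (bs_mem hz)).ne'
  have ho3 : z 0 ^ 2 - 1 ≠ 0 := by
    rw [show z 0 ^ 2 - 1 = (z 0 - 1) * (z 0 + 1) by ring]; exact mul_ne_zero hx hx'
  simp only [Hp, map_add, map_mul, map_pow, evm_C, evm_X, h0, h1, h2, h3, aA, evp_cst, map_sub, map_one,
    sX, sY, sE, sF, sB, evp_mkS, Ham, bs]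
  have e4 : mom z 0 = z 4 := rfl
  have e5 : mom z 1 = z 5 := rfl
  have e6 : mom z 2 = z 6 := rfl
  have e7 : mom z 3 = z 7 := rfl
  rw [e4, e5, e6, e7]
  rw [show z 0 ^ 2 - 1 = (z 0 - 1) * (z 0 + 1) by ring]
  field_simp
  ring
theorem Dc_CX2 (D : Derivation ℝ Sm Sm) (a : Sm) (n : Fin 4) : Dc D (C a * X n ^ 2) = C (D a) * X n ^ 2 := by
  rw [pow_two, ← mul_assoc, Dc_mulX, Dc_mulX, Dc_C, mul_assoc]
def Eop (P : RP) : RP :=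
  C (2 * h0) * (X 0 * Dc dx P) + C (2 * h1) * (X 1 * Dc dy P)
  - (C (dx h0) * (X 0 * (X 0 * pderiv 0 P)) + C (dx h1) * (X 1 * (X 1 * pderiv 0 P))
    + C (dx h2) * (X 2 * (X 2 * pderiv 0 P)) + C (dx h3) * (X 3 * (X 3 * pderiv 0 P)))
  - (C (dy h0) * (X 0 * (X 0 * pderiv 1 P)) + C (dy h1) * (X 1 * (X 1 * pderiv 1 P))
    + C (dy h2) * (X 2 * (X 2 * pderiv 1 P)) + C (dy h3) * (X 3 * (X 3 * pderiv 1 P)))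
theorem pd_Ham (i : Fin 8) {z : PhasePt} (hz : z ∈ TStar) : pd i Ham z = pd i (rep Hp) z := by
  unfold pd
  rw [(rep_ev (fun z hz => rep_Hp hz) hz).fderiv_eq]
theorem pois_Ham (P : RP) {z : PhasePt} (hz : z ∈ TStar) : pois Ham (rep P) z = - rep (Eop P) z := by
  have h := pd_rep P hz
  have g := pd_rep Hp hz
  simp only [pois, pd_Ham _ hz, h.1, h.2.1, h.2.2.1, h.2.2.2.1, h.2.2.2.2.1, h.2.2.2.2.2.1, g.1, g.2.1, g.2.2.1, g.2.2.2.1, g.2.2.2.2.1, g.2.2.2.2.2.1]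
  have e0 : pderiv 0 Hp = C (2 * h0) * X 0 := by
    simp [Hp, Derivation.leibniz, Derivation.leibniz_pow, pderiv_X, Pi.single_apply]
    rw [show (C 2 : RP) = 2 from map_ofNat C 2]; ring
  have e1 : pderiv 1 Hp = C (2 * h1) * X 1 := by
    simp [Hp, Derivation.leibniz, Derivation.leibniz_pow, pderiv_X, Pi.single_apply]
    rw [show (C 2 : RP) = 2 from map_ofNat C 2]; ring
  rw [e0, e1]
  simp only [Hp, Dc_add, Dc_CX2, Eop, rep_of _ hz, map_add, map_sub, map_mul, map_pow, evm_C, evm_X]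
  ring
theorem Eop_zero {P : RP} (h : ∀ z ∈ TStar, pois Ham (rep P) z = 0) : Eop P = 0 :=
  RP_zero fun z hz => by
    have := pois_Ham P hz
    rw [h z hz] at this; linarith
/-! integer indexed coefficients -/
def fs (v : Fin 4 → ℤ) : Fin 4 →₀ ℕ := Finsupp.equivFunOnFinite.symm fun n => (v n).toNat
def Uc (P : RP) (v : Fin 4 → ℤ) : Sm := if ∀ n, 0 ≤ v n then coeff (fs v) P else 0
theorem Uc_add (P Q : RP) (v) : Uc (P + Q) v = Uc P v + Uc Q v := by
  unfold Uc; split_ifs <;> simp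
theorem Uc_sub (P Q : RP) (v) : Uc (P - Q) v = Uc P v - Uc Q v := by
  unfold Uc; split_ifs <;> simp
theorem Uc_C (a : Sm) (Q : RP) (v) : Uc (C a * Q) v = a * Uc Q v := by
  unfold Uc; split_ifs <;> simp [coeff_C_mul]
theorem Uc_Dc (D) (Q : RP) (v) : Uc (Dc D Q) v = D (Uc Q v) := by
  unfold Uc; split_ifs <;> simp [coeff_Dc]
theorem Uc_X (n : Fin 4) (Q : RP) (v) : Uc (X n * Q) v = Uc Q (Function.update v n (v n - 1)) := by
  classical
  unfold Uc
  by_cases h : ∀ n, 0 ≤ v n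
  · rw [if_pos h, coeff_X_mul']
    by_cases hn : v n = 0
    · rw [if_neg, if_neg]
      · intro h'; have := h' n; simp [hn] at this
      · simp [fs, hn]
    · have hp : 1 ≤ v n := by have := h n; omega
      rw [if_pos, if_pos]
      · congr 1
        ext k
        by_cases hk : k = n
        · subst hk; simp [fs]
        · simp [fs, hk, Function.update_of_ne, Finsupp.single_apply, Ne.symm hk]
      · intro k
        by_cases hk : k = n
        · subst hk; simp; omega
        · simp [Function.update_of_ne hk, h k]
      · simp [fs]; omega
  · rw [if_neg h, if_neg]
    intro h'
    apply h
    intro k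
    have := h' k
    by_cases hk : k = n
    · subst hk; simp at this; omega
    · rwa [Function.update_of_ne hk] at this
theorem Uc_pderiv (n : Fin 4) (Q : RP) (v) (hv : ∀ k, k ≠ n → True) :
    Uc (pderiv n Q) v = ((v n + 1 : ℤ) : Sm) * Uc Q (Function.update v n (v n + 1)) := by
  classical
  unfold Uc
  by_cases h : ∀ n, 0 ≤ v n
  · rw [if_pos h, if_pos, coeff_pderiv]
    · have e : fs v + Finsupp.single n 1 = fs (Function.update v n (v n + 1)) := by
        ext k
        by_cases hk : k = n
        · subst hk; have := h k; simp [fs]; omega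
        · simp [fs, hk, Function.update_of_ne, Finsupp.single_apply, Ne.symm hk]
      rw [e]
      have : (((fs v) n : ℕ) : Sm) = ((v n : ℤ) : Sm) := by
        have := h n
        simp only [fs, Finsupp.equivFunOnFinite_symm_apply_apply]
        rw [← Int.cast_natCast, Int.toNat_of_nonneg this]
      rw [this]; push_cast; ring
    · intro k
      have := h k
      by_cases hk : k = n
      · subst hk; simp; omega
      · rwa [Function.update_of_ne hk]
  · rw [if_neg h]
    split_ifs with h'
    · have : v n = -1 := by
        by_contra hc
        apply h
        intro k
        have := h' k
        by_cases hk : k = n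
        · subst hk; simp at this; omega
        · rwa [Function.update_of_ne hk] at this
      rw [this]; simp
    · simp
def uc (P : RP) (i j k m : ℤ) : Sm := Uc P ![i, j, k, m]
theorem star {P : RP} (h : Eop P = 0) (i j k m : ℤ) :
    2 * h0 * dx (uc P (i-1) j k m) + 2 * h1 * dy (uc P i (j-1) k m)
    - (dx h0 * ((i - 1 : ℤ) * uc P (i-1) j k m) + dx h1 * ((i + 1 : ℤ) * uc P (i+1) (j-2) k m)
      + dx h2 * ((i + 1 : ℤ) * uc P (i+1) j (k-2) m) + dx h3 * ((i + 1 : ℤ) * uc P (i+1) j k (m-2)))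
    - (dy h0 * ((j + 1 : ℤ) * uc P (i-2) (j+1) k m) + dy h1 * ((j - 1 : ℤ) * uc P i (j-1) k m)
      + dy h2 * ((j + 1 : ℤ) * uc P i (j+1) (k-2) m) + dy h3 * ((j + 1 : ℤ) * uc P i (j+1) k (m-2))) = 0 := by
  have h' := congrArg (fun Q => Uc Q ![i, j, k, m]) h
  have u0 : ∀ i j k m a : ℤ, Function.update ![i, j, k, m] 0 a = ![a, j, k, m] := by
    intros; ext n; fin_cases n <;> rfl
  have u1 : ∀ i j k m a : ℤ, Function.update ![i, j, k, m] 1 a = ![i, a, k, m] := by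
    intros; ext n; fin_cases n <;> rfl
  have u2 : ∀ i j k m a : ℤ, Function.update ![i, j, k, m] 2 a = ![i, j, a, m] := by
    intros; ext n; fin_cases n <;> rfl
  have u3 : ∀ i j k m a : ℤ, Function.update ![i, j, k, m] 3 a = ![i, j, k, a] := by
    intros; ext n; fin_cases n <;> rfl
  have w0 : ∀ i j k m : ℤ, (![i, j, k, m] : Fin 4 → ℤ) 0 = i := fun _ _ _ _ => rfl
  have w1 : ∀ i j k m : ℤ, (![i, j, k, m] : Fin 4 → ℤ) 1 = j := fun _ _ _ _ => rfl
  have w2 : ∀ i j k m : ℤ, (![i, j, k, m] : Fin 4 → ℤ) 2 = k := fun _ _ _ _ => rfl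
  have w3 : ∀ i j k m : ℤ, (![i, j, k, m] : Fin 4 → ℤ) 3 = m := fun _ _ _ _ => rfl
  have z : Uc 0 ![i, j, k, m] = 0 := by simp [Uc]
  simp only [z, Eop, Uc_add, Uc_sub, Uc_C, Uc_X, Uc_Dc, Uc_pderiv _ _ _ (fun _ _ => trivial), u0, u1, u2, u3, w0, w1, w2, w3] at h'
  rw [show i - 1 - 1 + 1 = i - 1 by ring, show j - 1 - 1 + 1 = j - 1 by ring,
    show i - 1 - 1 = i - 2 by ring, show j - 1 - 1 = j - 2 by ring, show k - 1 - 1 = k - 2 by ring,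
    show m - 1 - 1 = m - 2 by ring] at h'
  exact h'
theorem uc_neg (P : RP) {i j k m : ℤ} (h : i < 0 ∨ j < 0 ∨ k < 0 ∨ m < 0) : uc P i j k m = 0 := by
  unfold uc Uc
  rw [if_neg]
  intro hh
  have a0 : 0 ≤ i := hh 0
  have a1 : 0 ≤ j := hh 1
  have a2 : 0 ≤ k := hh 2
  have a3 : 0 ≤ m := hh 3
  omega
theorem uc_deg (P : RP) (hP : P.totalDegree ≤ 6) {i j k m : ℤ} (h : 6 < i + j + k + m) : uc P i j k m = 0 := by
  unfold uc Uc
  split_ifs with hh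
  · apply coeff_eq_zero_of_totalDegree_lt
    refine lt_of_le_of_lt hP ?_
    have a0 : 0 ≤ i := hh 0
    have a1 : 0 ≤ j := hh 1
    have a2 : 0 ≤ k := hh 2
    have a3 : 0 ≤ m := hh 3
    have : (fs ![i, j, k, m]).degree = i.toNat + j.toNat + k.toNat + m.toNat := by
      rw [Finsupp.degree_eq_sum, Fin.sum_univ_four]; rfl
    change 6 < (fs ![i, j, k, m]).degree
    omega
  · rfl
theorem uc_zero {P : RP} (h : ∀ i j k m, uc P i j k m = 0) : P = 0 := by
  refine MvPolynomial.ext _ _ fun m => ?_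
  have := h (m 0) (m 1) (m 2) (m 3)
  unfold uc Uc at this
  rw [if_pos (by intro n; fin_cases n <;> simp)] at this
  have e : fs ![(m 0 : ℤ), m 1, m 2, m 3] = m := by
    ext n; fin_cases n <;> rfl
  rw [e] at this
  simpa using this
end ZV

set_option linter.unusedSimpArgs false
/-! ### Vanishing along `y = 0` -/
namespace ZV
def Yp (b : ℕ) : Sm →ₗ[ℝ] Sm := (dy : Sm →ₗ[ℝ] Sm) ^ b
@[simp] theorem Yp_zero (f : Sm) : Yp 0 f = f := rfl
theorem Yp_succ (b : ℕ) (f : Sm) : Yp (b + 1) f = Yp b (dy f) := by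
  simp only [Yp, pow_succ]; rfl
theorem Yp_dx (b : ℕ) (f : Sm) : Yp b (dx f) = dx (Yp b f) := by
  induction b generalizing f with
  | zero => rfl
  | succ b ih => rw [Yp_succ, ← dxy, ih, Yp_succ]
def Van (b : ℕ) (f : Sm) : Prop := ∀ b' < b, ∀ x hx, evp (pt x hx) (Yp b' f) = 0
theorem Van.mono {b c : ℕ} {f : Sm} (h : Van b f) (hc : c ≤ b) : Van c f := fun b' hb' => h b' (by omega)
theorem Van.dy {b : ℕ} {f : Sm} (h : Van (b + 1) f) : Van b (dy f) := fun b' hb' x hx => by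
  rw [← Yp_succ]; exact h _ (by omega) x hx
theorem line_zero {f : Sm} (h : ∀ x hx, evp (pt x hx) f = 0) : ∀ x hx, evp (pt x hx) (dx f) = 0 := by
  intro x hx
  have h1 := line_deriv f x hx
  have h2 : (fun x => exS f (x, 0)) =ᶠ[nhds x] fun _ => (0 : ℝ) := by
    filter_upwards [lt_mem_nhds hx] with y hy
    rw [exS_pt f y hy, h]
  exact h1.unique ((hasDerivAt_const x (0 : ℝ)).congr_of_eventuallyEq h2)
theorem Van.dx {b : ℕ} {f : Sm} (h : Van b f) : Van b (dx f) := fun b' hb' x hx => by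
  rw [Yp_dx]; exact line_zero (h b' hb') x hx
theorem Yp_mul (b : ℕ) (e : Sm) {f : Sm} (h : Van b f) (x hx) :
    evp (pt x hx) (Yp b (e * f)) = evp (pt x hx) e * evp (pt x hx) (Yp b f) := by
  induction b generalizing e f with
  | zero => simp
  | succ b ih =>
    rw [Yp_succ, Derivation.leibniz, smul_eq_mul, smul_eq_mul, map_add, map_add, ih e h.dy, mul_comm f,
      ih _ (h.mono (by omega)), h b (by omega), Yp_succ]
    ring
theorem Van.mul {b : ℕ} (e : Sm) {f : Sm} (h : Van b f) : Van b (e * f) := fun b' hb' x hx => by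
  rw [Yp_mul b' e (h.mono hb'.le), h b' hb', mul_zero]
theorem Yp_sY (b : ℕ) (f : Sm) (x hx) :
    evp (pt x hx) (Yp b (sY * f)) = b * evp (pt x hx) (Yp (b - 1) f) := by
  induction b generalizing f with
  | zero => simp [sY, pt]
  | succ b ih =>
    rw [Yp_succ, Derivation.leibniz, smul_eq_mul, smul_eq_mul, map_add, map_add, ih, dy_sY, mul_one]
    rcases b with _ | b
    · simp
    · rw [show b + 1 - 1 = b by omega, show b + 1 + 1 - 1 = b + 1 by omega, ← Yp_succ]
      push_cast; ring
/-! values on the line -/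
def k0 : Sm := cst (-3) * ((sX ^ 2 - sY ^ 2) ^ 2 * sE ^ 6 * sF ^ 2 * (sX ^ 2 - 1))
def k1 : Sm := cst (-3) * ((sX ^ 2 - sY ^ 2) ^ 2 * sE ^ 6 * sF ^ 2 * (1 - sY ^ 2)) - aA
theorem dy_h0 : dy h0 = sY * k0 := by
  apply Sm_ext; intro z
  simp only [h0, k0, aA, Derivation.leibniz, Derivation.leibniz_pow, smul_eq_mul, nsmul_eq_mul, dy_sX, dy_sY, dy_sE, dy_sF, d_cst,
    map_sub, map_add, map_mul, map_pow, map_one, map_zero, evp_cst, Derivation.map_one_eq_zero, map_natCast]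
  push_cast; ring
theorem dy_h1 : dy h1 = sY * k1 := by
  apply Sm_ext; intro z
  simp only [h1, k1, aA, Derivation.leibniz, Derivation.leibniz_pow, smul_eq_mul, nsmul_eq_mul, dy_sX, dy_sY, dy_sE, dy_sF, d_cst,
    map_sub, map_add, map_mul, map_pow, map_one, map_zero, evp_cst, Derivation.map_one_eq_zero, map_natCast]
  push_cast; ring
theorem dy_h3 : dy h3 = 0 := by
  simp [h3, Derivation.leibniz, Derivation.leibniz_pow]
def Nn (x : ℝ) : ℝ := x ^ 6 / ((x + 1) ^ 6 * (x - 1) ^ 2)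
theorem Nn_pos {x : ℝ} (hx : 1 < x) : 0 < Nn x := by
  have : 0 < x - 1 := by linarith
  have : 0 < x := by linarith
  unfold Nn; positivity
theorem ev_h0 (x hx) : evp (pt x hx) h0 = Nn x * (x ^ 2 - 1) / 2 := by
  simp [h0, aA, sX, sY, sE, sF, Nn, pt]; field_simp
theorem ev_h1 (x hx) : evp (pt x hx) h1 = Nn x / 2 := by
  simp [h1, aA, sX, sY, sE, sF, Nn, pt]; field_simp
theorem ev_dxh0 (x hx) : evp (pt x hx) (dx h0) = Nn x * (2 - 3 / x) := by
  have h1 : x - 1 ≠ 0 := by linarith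
  have h2 : x + 1 ≠ 0 := by linarith
  have h3 : x ≠ 0 := by linarith
  simp only [h0, aA, Derivation.leibniz, Derivation.leibniz_pow, smul_eq_mul, nsmul_eq_mul, dx_sX, dx_sY, dx_sE, dx_sF, d_cst,
    map_sub, map_add, map_mul, map_pow, map_one, map_zero, map_neg, evp_cst, Derivation.map_one_eq_zero, map_natCast]
  simp only [sX, sY, sE, sF, evp_mkS, pt, Nn]
  push_cast; field_simp; ring
theorem ev_dxh3 (x hx) : evp (pt x hx) (dx h3) = 2 * (x + 1) / (x - 1) ^ 3 := by
  have h1 : x - 1 ≠ 0 := by linarith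
  simp only [h3, aA, Derivation.leibniz, Derivation.leibniz_pow, smul_eq_mul, nsmul_eq_mul, dx_sX, dx_sY, dx_sE, dx_sF, d_cst,
    map_sub, map_add, map_mul, map_pow, map_one, map_zero, map_neg, evp_cst, Derivation.map_one_eq_zero, map_natCast]
  simp only [sX, sY, sE, sF, evp_mkS, pt, Nn]
  push_cast; field_simp; ring
theorem ev_k0 (x hx) : evp (pt x hx) k0 = -3 * Nn x * (x ^ 2 - 1) / x ^ 2 := by
  have h3 : x ≠ 0 := by linarith
  simp [k0, sX, sY, sE, sF, Nn, pt]; field_simp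
structure Slice (v : ℤ → ℤ → ℤ → Sm) : Prop where
  eq : ∀ i j m, 2 * h0 * dx (v (i-1) j m) + 2 * h1 * dy (v i (j-1) m)
    - (dx h0 * ((i - 1 : ℤ) * v (i-1) j m) + dx h1 * ((i + 1 : ℤ) * v (i+1) (j-2) m)
      + dx h3 * ((i + 1 : ℤ) * v (i+1) j (m-2)))
    - (dy h0 * ((j + 1 : ℤ) * v (i-2) (j+1) m) + dy h1 * ((j - 1 : ℤ) * v i (j-1) m)) = 0
  neg : ∀ i j m, i < 0 ∨ j < 0 ∨ m < 0 → v i j m = 0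
  deg : ∀ i j m, 6 < i + j + m → v i j m = 0
  zero : ∀ i m x hx, evp (pt x hx) (v i 0 m) = 0
variable {v : ℤ → ℤ → ℤ → Sm}
theorem Slice.lead (hv : Slice v) (M : ℤ) (ih : ∀ (b : ℕ) (j : ℤ), b + j < M → ∀ i m x hx, evp (pt x hx) (Yp b (v i j m)) = 0)
    (b : ℕ) (i j m : ℤ) (hb : b + j = M) (x hx) :
    Nn x * (x ^ 2 - 1) * evp (pt x hx) (dx (Yp b (v (i-1) j m))) + Nn x * evp (pt x hx) (Yp (b + 1) (v i (j-1) m))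
    - Nn x * (2 - 3 / x) * (i - 1) * evp (pt x hx) (Yp b (v (i-1) j m))
    - 2 * (x + 1) / (x - 1) ^ 3 * (i + 1) * evp (pt x hx) (Yp b (v (i+1) j (m-2)))
    + 3 * Nn x * (x ^ 2 - 1) / x ^ 2 * (j + 1) * (b * evp (pt x hx) (Yp (b - 1) (v (i-2) (j+1) m))) = 0 := by
  have hV : ∀ (b : ℕ) (i j m : ℤ), b + j ≤ M → Van b (v i j m) := fun b i j m h b' hb' x hx =>
    ih b' j (by omega) i m x hx
  have e := congrArg (fun f => evp (pt x hx) (Yp b f)) (hv.eq i j m)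
  simp only [map_sub, map_add, map_zero] at e
  rw [Yp_mul b _ (hV b (i-1) j m (by omega)).dx, Yp_mul b _ (hV (b+1) i (j-1) m (by push_cast; omega)).dy,
    Yp_mul b _ ((hV b (i-1) j m (by omega)).mul _), Yp_mul b _ (hV b (i-1) j m (by omega)),
    Yp_mul b _ ((hV b (i+1) (j-2) m (by omega)).mul _), Yp_mul b _ (hV b (i+1) (j-2) m (by omega)),
    Yp_mul b _ ((hV b (i+1) j (m-2) (by omega)).mul _), Yp_mul b _ (hV b (i+1) j (m-2) (by omega)),
    dy_h0, dy_h1, mul_assoc sY, mul_assoc sY, Yp_sY, Yp_sY,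
    ← Yp_succ, Yp_dx, ih b (j-2) (by omega)] at e
  have hn : ∀ n : ℤ, evp (pt x hx) (n : Sm) = n := fun n => by simp
  have e2 : (b : ℝ) * evp (pt x hx) (Yp (b - 1) (k0 * (((j + 1 : ℤ) : Sm) * v (i - 2) (j + 1) m)))
     = b * (evp (pt x hx) k0 * ((j + 1) * evp (pt x hx) (Yp (b - 1) (v (i - 2) (j + 1) m)))) := by
    rcases b with _ | b
    · simp
    · have hh := hV b (i-2) (j+1) m (by push_cast at hb; omega)
      rw [show b + 1 - 1 = b by omega, Yp_mul b _ (hh.mul _), Yp_mul b _ hh, hn]; push_cast; ring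
  have e3 : (b : ℝ) * evp (pt x hx) (Yp (b - 1) (k1 * (((j - 1 : ℤ) : Sm) * v i (j - 1) m))) = 0 := by
    rcases b with _ | b
    · simp
    · have hh := hV b i (j-1) m (by push_cast at hb; omega)
      rw [show b + 1 - 1 = b by omega, Yp_mul b _ (hh.mul _), Yp_mul b _ hh, ih b _ (by push_cast at hb; omega)]; simp
  rw [e2, e3] at e
  simp only [hn, map_mul, map_ofNat, ev_h0, ev_h1, ev_dxh0, ev_dxh3, ev_k0] at e
  push_cast at e
  linear_combination e
theorem Slice.nve (hv : Slice v) (M : ℕ) (hM : M ≤ 6) : ∀ (b : ℕ) (j : ℤ), b + j = M → ∀ i m x hx, evp (pt x hx) (Yp b (v i j m)) = 0 := by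
  induction M using Nat.strong_induction_on with
  | _ M ih =>
  have ih' : ∀ (b : ℕ) (j : ℤ), b + j < M → ∀ i m x hx, evp (pt x hx) (Yp b (v i j m)) = 0 := by
    intro b j hb i m x hx
    rcases lt_or_ge j 0 with hj | hj
    · rw [hv.neg _ _ _ (by omega)]; simp
    · exact ih (b + j.toNat) (by omega) (by omega) b j (by omega) i m x hx
  rcases Nat.eq_zero_or_pos M with h0 | hpos
  · intro b j hb i m x hx
    rcases Nat.eq_zero_or_pos b with hb0 | hb0
    · have : j = 0 := by omega
      subst this hb0; exact hv.zero i m x hx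
    · rw [hv.neg _ _ _ (by omega)]; simp
  set γ : ℤ → ℤ → ℤ → ℝ → ℝ := fun i j m x =>
    if j ≤ M then exS (Yp (M - j).toNat (v i j m)) (x, 0) / ((M - j).toNat.factorial : ℝ) else 0 with hγ
  have hγz : ∀ i j m, v i j m = 0 → ∀ x > 1, γ i j m x = 0 := by
    intro i j m h x hx
    simp only [hγ, h, map_zero, exS_pt _ x hx]; simp
  have key : ∀ w m0 : ℤ, (w = 5 ∨ w = 6) → ∀ j t x, 1 < x → γ (w - j - 2 * t) j (m0 + 2 * t) x = 0 := by
    intro w m0 hw j t x hx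
    have hs : NV.Sys w M (fun j t x => ((x + 1) ^ 3 / x ^ 3) ^ (w - 2 * t) * γ (w - j - 2 * t) j (m0 + 2 * t) x) := by
      constructor
      · intro j t h x hx
        simp only [NV.inR, Bool.and_eq_false_iff, decide_eq_false_iff_not] at h
        have : γ (w - j - 2 * t) j (m0 + 2 * t) x = 0 := by
          by_cases hj : j ≤ M
          · apply hγz _ _ _ _ x hx
            by_cases hm : m0 + 2 * t < 0
            · exact hv.neg _ _ _ (by omega)
            by_cases ht : t < 0
            · exact hv.deg _ _ _ (by omega)
            · exact hv.neg _ _ _ (by omega)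
          · simp [hγ, hj]
        simp only [this, mul_zero]
      · intro j t hj x hx
        obtain ⟨b, hb⟩ : ∃ b : ℕ, b + j = M := ⟨(M - j).toNat, by omega⟩
        have hl := hv.lead M ih' b (w - j - 2 * t + 1) j (m0 + 2 * t) hb x hx
        have hb1 : (M - j).toNat = b := by omega
        have g0 : ∀ i m x, γ i j m x = exS (Yp b (v i j m)) (x, 0) / (b.factorial : ℝ) := by
          intro i m x; simp only [hγ, if_pos hj, hb1]
        have g1 : ∀ i m, γ i (j-1) m x = evp (pt x hx) (Yp (b+1) (v i (j-1) m)) / ((b+1).factorial : ℝ) := by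
          intro i m; simp only [hγ]
          rw [if_pos (by omega), show (M - (j - 1)).toNat = b + 1 by omega, exS_pt _ x hx]
        have g2 : ∀ i m, γ i (j+1) m x = b * evp (pt x hx) (Yp (b-1) (v i (j+1) m)) / (b.factorial : ℝ) := by
          intro i m; simp only [hγ]
          rcases b with _ | b
          · rw [if_neg (by omega)]; simp
          · rw [if_pos (by push_cast at hb; omega), show (M - (j + 1)).toNat = b by omega, exS_pt _ x hx, show b + 1 - 1 = b by omega,
              Nat.factorial_succ]
            have : (b.factorial : ℝ) ≠ 0 := by positivity
            push_cast; field_simp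
        have hx0 : x ≠ 0 := by linarith
        have hx1 : x - 1 ≠ 0 := by linarith
        have hx2 : x + 1 ≠ 0 := by linarith
        have hρ : HasDerivAt (fun x : ℝ => (x + 1) ^ 3 / x ^ 3) (-3 / (x * (x + 1)) * ((x + 1) ^ 3 / x ^ 3)) x := by
          have := (((hasDerivAt_id x).add_const 1).pow 3).div ((hasDerivAt_id x).pow 3) (by simpa using hx0)
          refine this.congr_deriv ?_
          simp; field_simp; ring
        have hρ0 : (x + 1) ^ 3 / x ^ 3 ≠ 0 := by positivity
        have hρn : HasDerivAt (fun x : ℝ => ((x + 1) ^ 3 / x ^ 3) ^ (w - 2 * t))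
            ((w - 2 * t : ℤ) * (-3 / (x * (x + 1))) * ((x + 1) ^ 3 / x ^ 3) ^ (w - 2 * t)) x := by
          refine ((hasDerivAt_zpow (w - 2 * t) _ (Or.inl hρ0)).comp x hρ).congr_deriv ?_
          rw [zpow_sub_one₀ hρ0]; field_simp
        have hd := (line_deriv (Yp b (v (w - j - 2 * t) j (m0 + 2 * t))) x hx).div_const (b.factorial : ℝ)
        refine ⟨_, by
          simp only [g0]
          exact hρn.mul hd, ?_⟩
        have z1 : w - j - 2 * (t - 1) = w - j - 2 * t + 2 := by ring
        have z2 : m0 + 2 * (t - 1) = m0 + 2 * t - 2 := by ring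
        have z3 : w - (j - 1) - 2 * t = w - j - 2 * t + 1 := by ring
        have z4 : w - (j + 1) - 2 * t = w - j - 2 * t - 1 := by ring
        have z5 : ((x + 1) ^ 3 / x ^ 3) ^ (w - 2 * (t - 1)) = ((x + 1) ^ 3 / x ^ 3) ^ (w - 2 * t) * ((x + 1) ^ 3 / x ^ 3) ^ 2 := by
          rw [show w - 2 * (t - 1) = w - 2 * t + 2 by ring, zpow_add₀ hρ0]; norm_cast
        simp only [z1, z2, z3, z4, z5, g0, g1, g2, exS_pt _ x hx]
        rw [show w - j - 2 * t + 1 - 1 = w - j - 2 * t by ring, show w - j - 2 * t + 1 + 1 = w - j - 2 * t + 2 by ring,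
          show w - j - 2 * t + 1 - 2 = w - j - 2 * t - 1 by ring] at hl
        have hbf : ((b + 1).factorial : ℝ) = (b + 1) * b.factorial := by rw [Nat.factorial_succ]; push_cast; ring
        have hMb : (M : ℝ) - j = b := by
          have : (b : ℝ) + j = M := by exact_mod_cast hb
          linarith
        rw [hbf]
        push_cast
        rw [hMb]
        have hb0 : (b.factorial : ℝ) ≠ 0 := by positivity
        have hb2 : (b : ℝ) + 1 ≠ 0 := by positivity
        have hl' := hl
        generalize evp (pt x hx) (dx (Yp b (v (w - j - 2 * t) j (m0 + 2 * t)))) = G1 at hl ⊢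
        generalize evp (pt x hx) (Yp b (v (w - j - 2 * t) j (m0 + 2 * t))) = G2 at hl ⊢
        generalize evp (pt x hx) (Yp b (v (w - j - 2 * t + 2) j (m0 + 2 * t - 2))) = G3 at hl ⊢
        generalize evp (pt x hx) (Yp (b+1) (v (w - j - 2 * t + 1) (j - 1) (m0 + 2 * t))) = G4 at hl ⊢
        generalize evp (pt x hx) (Yp (b-1) (v (w - j - 2 * t - 1) (j + 1) (m0 + 2 * t))) = G5 at hl ⊢
        generalize ((x + 1) ^ 3 / x ^ 3) ^ (w - 2 * t) = R
        generalize (b.factorial : ℝ) = f at hb0 ⊢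
        unfold NV.cc
        unfold Nn at hl
        push_cast at hl
        have hl2 := congrArg (fun q => q * ((2 * x / (x - 1)) ^ 2 * R / f * ((x + 1) ^ 6 * (x - 1) ^ 2 / x ^ 6))) hl
        simp only [zero_mul] at hl2
        refine sub_eq_zero.1 (Eq.trans ?_ hl2)
        field_simp
        ring
    obtain ⟨n, hn⟩ := NV.chk_all w M hw (by omega) (by omega)
    have := NV.nve hs (by omega) (by omega) n hn j t x hx
    simp only [mul_eq_zero] at this
    rcases this with h | h
    · exact absurd h (by
        have : (0:ℝ) < x := by linarith
        positivity)
    · exact h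
  intro b j hb i m x hx
  by_cases hij : 6 < i + j
  · by_cases hm : m < 0
    · rw [hv.neg _ _ _ (by omega)]; simp
    · rw [hv.deg _ _ _ (by omega)]; simp
  obtain ⟨w, t, hw, ht⟩ : ∃ w t : ℤ, (w = 5 ∨ w = 6) ∧ 2 * t = w - (i + j) := by
    rcases Int.even_or_odd' (i + j) with ⟨q, hq | hq⟩
    · exact ⟨6, 3 - q, by omega, by omega⟩
    · exact ⟨5, 2 - q, by omega, by omega⟩
  have := key w (m - 2 * t) hw j t x hx
  rw [show w - j - 2 * t = i by omega, show m - 2 * t + 2 * t = m by omega] at this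
  simp only [hγ] at this
  rw [if_pos (by omega), show ((M:ℤ) - j).toNat = b by omega, exS_pt _ x hx, div_eq_zero_iff] at this
  rcases this with h | h
  · exact h
  · exact absurd h (by positivity)
theorem Slice.van (hv : Slice v) (i j m x hx) : evp (pt x hx) (v i j m) = 0 := by
  rcases lt_or_ge j 0 with hj | hj
  · rw [hv.neg _ _ _ (by omega)]; simp
  by_cases h6 : j ≤ 6
  · exact hv.nve j.toNat (by omega) 0 j (by omega) i m x hx
  · by_cases hm : i < 0 ∨ m < 0
    · rw [hv.neg _ _ _ (by omega)]; simp
    · rw [hv.deg _ _ _ (by omega)]; simp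
end ZV

/-! ### The Cauchy problem for the two-dimensional homogeneous system -/
namespace ZV
open Complex in
theorem wfd (f : Sm) (ζ : ℂ) (hz : (Real.cosh ζ.re, Real.sin ζ.im) ∈ Om) :
    ∃ L : ℂ →L[ℝ] ℂ, HasFDerivAt (fun ζ : ℂ => ((exS f (Real.cosh ζ.re, Real.sin ζ.im) : ℝ) : ℂ)) L ζ ∧
      ∀ v, L v = ((evp ⟨_, hz⟩ (dx f) * (Real.sinh ζ.re * v.re) + evp ⟨_, hz⟩ (dy f) * (Real.cos ζ.im * v.im) : ℝ) : ℂ) := by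
  have h1 := (Real.hasDerivAt_cosh ζ.re).comp_hasFDerivAt ζ reCLM.hasFDerivAt
  have h2 := (Real.hasDerivAt_sin ζ.im).comp_hasFDerivAt ζ imCLM.hasFDerivAt
  have h3 := ofRealCLM.hasFDerivAt.comp ζ ((exS_hasFDeriv f ⟨_, hz⟩).comp ζ (h1.prodMk h2))
  refine ⟨_, h3, fun v => ?_⟩
  simp
open Complex in
theorem pfd (ζ : ℂ) (hz : Real.sinh ζ.re ≠ 0) :
    ∃ L : ℂ →L[ℝ] ℂ, HasFDerivAt (fun ζ : ℂ => (((Real.sinh ζ.re)⁻¹ : ℝ) : ℂ)) L ζ ∧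
      ∀ v, L v = ((-Real.cosh ζ.re / Real.sinh ζ.re ^ 2 * v.re : ℝ) : ℂ) := by
  have h1 := ((Real.hasDerivAt_sinh ζ.re).inv hz).comp_hasFDerivAt ζ reCLM.hasFDerivAt
  have h3 := ofRealCLM.hasFDerivAt.comp ζ h1
  refine ⟨_, h3, fun v => ?_⟩
  simp
open Complex in
theorem qfd (ζ : ℂ) (hz : Real.cos ζ.im ≠ 0) :
    ∃ L : ℂ →L[ℝ] ℂ, HasFDerivAt (fun ζ : ℂ => I * (((Real.cos ζ.im)⁻¹ : ℝ) : ℂ)) L ζ ∧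
      ∀ v, L v = I * ((Real.sin ζ.im / Real.cos ζ.im ^ 2 * v.im : ℝ) : ℂ) := by
  have h1 := ((Real.hasDerivAt_cos ζ.im).inv hz).comp_hasFDerivAt ζ imCLM.hasFDerivAt
  have h3 := (ofRealCLM.hasFDerivAt.comp ζ h1).const_mul I
  refine ⟨_, h3, fun v => ?_⟩
  simp
theorem tfd {w p q : ℂ → ℂ} {ζ : ℂ} {Lw Lp Lq : ℂ →L[ℝ] ℂ} (hw : HasFDerivAt w Lw ζ) (hp : HasFDerivAt p Lp ζ)
    (hq : HasFDerivAt q Lq ζ) (hp0 : p ζ ≠ 0) (hq0 : q ζ ≠ 0) (i k : ℤ) :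
    ∃ L : ℂ →L[ℝ] ℂ, HasFDerivAt (fun ζ => w ζ * p ζ ^ i * q ζ ^ k) L ζ ∧
      ∀ v, L v = Lw v * p ζ ^ i * q ζ ^ k + w ζ * (i * (p ζ ^ i * (p ζ)⁻¹) * Lp v) * q ζ ^ k
        + w ζ * p ζ ^ i * (k * (q ζ ^ k * (q ζ)⁻¹) * Lq v) := by
  have h1 := (hasDerivAt_zpow i (p ζ) (Or.inl hp0)).comp_hasFDerivAt ζ hp
  have h2 := (hasDerivAt_zpow k (q ζ) (Or.inl hq0)).comp_hasFDerivAt ζ hq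
  refine ⟨_, (hw.mul h1).mul h2, fun v => ?_⟩
  simp [zpow_sub_one₀ hp0, zpow_sub_one₀ hq0]
  ring
theorem dx_h0' : dx h0 = cst (1/2) * dx aA * (sX ^ 2 - 1) + aA * sX := by
  apply Sm_ext; intro z
  simp only [h0, Derivation.leibniz, Derivation.leibniz_pow, smul_eq_mul, nsmul_eq_mul, dx_sX, d_cst,
    map_sub, map_add, map_mul, map_pow, map_one, map_zero, evp_cst, Derivation.map_one_eq_zero, map_natCast]
  push_cast; ring
theorem dx_h1' : dx h1 = cst (1/2) * dx aA * (1 - sY ^ 2) := by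
  apply Sm_ext; intro z
  simp only [h1, Derivation.leibniz, Derivation.leibniz_pow, smul_eq_mul, nsmul_eq_mul, dx_sY, d_cst,
    map_sub, map_add, map_mul, map_pow, map_one, map_zero, evp_cst, Derivation.map_one_eq_zero, map_natCast]
  ring
theorem dy_h0' : dy h0 = cst (1/2) * dy aA * (sX ^ 2 - 1) := by
  apply Sm_ext; intro z
  simp only [h0, Derivation.leibniz, Derivation.leibniz_pow, smul_eq_mul, nsmul_eq_mul, dy_sX, d_cst,
    map_sub, map_add, map_mul, map_pow, map_one, map_zero, evp_cst, Derivation.map_one_eq_zero, map_natCast]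
  ring
theorem dy_h1' : dy h1 = cst (1/2) * dy aA * (1 - sY ^ 2) - aA * sY := by
  apply Sm_ext; intro z
  simp only [h1, Derivation.leibniz, Derivation.leibniz_pow, smul_eq_mul, nsmul_eq_mul, dy_sY, d_cst,
    map_sub, map_add, map_mul, map_pow, map_one, map_zero, evp_cst, Derivation.map_one_eq_zero, map_natCast]
  push_cast; ring
def eN (n i : ℤ) (W : ℤ → Sm) : Sm :=
  2 * h0 * dx (W (i-1)) + 2 * h1 * dy (W i)
    - (dx h0 * ((i - 1 : ℤ) * W (i-1)) + dx h1 * ((i + 1 : ℤ) * W (i+1)))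
    - (dy h0 * ((n + 2 - i : ℤ) * W (i-2)) + dy h1 * ((n - i : ℤ) * W i))
theorem sum_shift (f : ℤ → ℂ) (n s : ℤ) (hf : ∀ i, i < 0 ∨ n < i → f i = 0) (h1 : -2 ≤ s) (h2 : s ≤ 2) :
    ∑ i ∈ Finset.Icc (-2) (n + 2), f (i + s) = ∑ i ∈ Finset.Icc 0 n, f i := by
  have : ∑ i ∈ Finset.Icc (-2) (n + 2), f (i + s) = ∑ i ∈ Finset.Icc (-2 + s) (n + 2 + s), f i := by
    refine Finset.sum_bij (fun i _ => i + s) ?_ ?_ ?_ ?_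
    · intro a ha; simp at ha ⊢; omega
    · intro a _ b _ h; simpa using h
    · intro b hb; exact ⟨b - s, by simp at hb ⊢; omega, by ring⟩
    · intros; rfl
  rw [this]
  symm
  refine Finset.sum_subset ?_ ?_
  · intro i hi; simp at hi ⊢; omega
  · intro i _ hi; apply hf; simp at hi; omega
def dom : Set ℂ := {ζ | 0 < ζ.re ∧ -(π/2) < ζ.im ∧ ζ.im < π/2}
theorem dom_om {ζ : ℂ} (h : ζ ∈ dom) : (Real.cosh ζ.re, Real.sin ζ.im) ∈ Om := by
  refine ⟨Real.one_lt_cosh.2 h.1.ne', ?_, ?_⟩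
  · have := Real.sin_lt_sin_of_lt_of_le_pi_div_two (le_refl _) h.2.2.le h.2.1
    simpa using this
  · have := Real.sin_lt_sin_of_lt_of_le_pi_div_two h.2.1.le (le_refl _) h.2.2
    simpa using this
theorem isOpen_dom : IsOpen dom :=
  (isOpen_lt continuous_const Complex.continuous_re).inter
    ((isOpen_lt continuous_const Complex.continuous_im).inter (isOpen_lt Complex.continuous_im continuous_const))
theorem conv_dom : Convex ℝ dom :=
  (convex_halfSpace_re_gt 0).inter ((convex_halfSpace_im_gt _).inter (convex_halfSpace_im_lt _))
def pP (ζ : ℂ) : ℂ := (((Real.sinh ζ.re)⁻¹ : ℝ) : ℂ)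
def qQ (ζ : ℂ) : ℂ := Complex.I * (((Real.cos ζ.im)⁻¹ : ℝ) : ℂ)
def FF (n : ℤ) (W : ℤ → Sm) (ζ : ℂ) : ℂ :=
  ∑ i ∈ Finset.Icc 0 n, ((exS (W i) (Real.cosh ζ.re, Real.sin ζ.im) : ℝ) : ℂ) * pP ζ ^ i * qQ ζ ^ (n - i)
theorem FF_diff (n : ℤ) (W : ℤ → Sm) (hW : ∀ i, i < 0 ∨ n < i → W i = 0) (hE : ∀ i, eN n i W = 0)
    (ζ : ℂ) (hζ : ζ ∈ dom) : DifferentiableAt ℂ (FF n W) ζ := by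
  have hs : Real.sinh ζ.re ≠ 0 := (Real.sinh_pos_iff.2 hζ.1).ne'
  have hc : Real.cos ζ.im ≠ 0 := (Real.cos_pos_of_mem_Ioo ⟨hζ.2.1, hζ.2.2⟩).ne'
  have hz := dom_om hζ
  have hp0 : pP ζ ≠ 0 := Complex.ofReal_ne_zero.2 (inv_ne_zero hs)
  have hq0 : qQ ζ ≠ 0 := mul_ne_zero Complex.I_ne_zero (Complex.ofReal_ne_zero.2 (inv_ne_zero hc))
  obtain ⟨Lp, hp, hp'⟩ := pfd ζ hs
  obtain ⟨Lq, hq, hq'⟩ := qfd ζ hc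
  choose Lw hw hw' using fun i => wfd (W i) ζ hz
  choose L hL hL' using fun i => tfd (hw i) hp hq hp0 hq0 i (n - i)
  have hF : HasFDerivAt (FF n W) (∑ i ∈ Finset.Icc 0 n, L i) ζ := HasFDerivAt.fun_sum fun i _ => hL i
  rw [differentiableAt_complex_iff_differentiableAt_real]
  refine ⟨hF.differentiableAt, ?_⟩
  rw [hF.fderiv]
  have hA : (evp ⟨_, hz⟩ aA : ℝ) ≠ 0 := by
    have := om2 hz
    simp only [aA, sX, sY, sE, sF, map_mul, map_pow, map_sub, evp_mkS]
    have h1 : Real.cosh ζ.re + 1 ≠ 0 := by have h3 : 1 < Real.cosh ζ.re := hz.1; positivity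
    have h2 : Real.cosh ζ.re - 1 ≠ 0 := by have h3 : 1 < Real.cosh ζ.re := hz.1; linarith
    positivity
  have key : ((evp ⟨_, hz⟩ aA : ℝ) : ℂ) * ((∑ i ∈ Finset.Icc 0 n, L i) 1 + Complex.I * (∑ i ∈ Finset.Icc 0 n, L i) Complex.I) = 0 := by
    set ev : Sm → ℂ := fun f => ((evp ⟨_, hz⟩ f : ℝ) : ℂ) with hev
    have s1 : ∑ i ∈ Finset.Icc (-2) (n + 2), ev (eN n i W) * (pP ζ ^ i * qQ ζ ^ (n + 1 - i)) = 0 := by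
      apply Finset.sum_eq_zero; intro i _; simp [hE, hev]
    set g1 : ℤ → ℂ := fun l => ev (2 * h0 * dx (W l) - dx h0 * (l * W l)) * (pP ζ ^ (l + 1) * qQ ζ ^ (n - l)) with hg1
    set g2 : ℤ → ℂ := fun l => ev (2 * h1 * dy (W l) - dy h1 * ((n - l : ℤ) * W l)) * (pP ζ ^ l * qQ ζ ^ (n + 1 - l)) with hg2
    set g3 : ℤ → ℂ := fun l => ev (dx h1 * (l * W l)) * (pP ζ ^ (l - 1) * qQ ζ ^ (n + 2 - l)) with hg3
    set g4 : ℤ → ℂ := fun l => ev (dy h0 * ((n - l : ℤ) * W l)) * (pP ζ ^ (l + 2) * qQ ζ ^ (n - 1 - l)) with hg4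
    have s2 : ∀ i, ev (eN n i W) * (pP ζ ^ i * qQ ζ ^ (n + 1 - i)) = g1 (i + -1) + g2 (i + 0) - g3 (i + 1) - g4 (i + -2) := by
      intro i
      simp only [hg1, hg2, hg3, hg4, hev, eN]
      rw [show i + -1 + 1 = i by ring, show n - (i + -1) = n + 1 - i by ring, show i + 0 = i by ring,
        show i + 1 - 1 = i by ring, show n + 2 - (i + 1) = n + 1 - i by ring, show i + -2 + 2 = i by ring,
        show n - 1 - (i + -2) = n + 1 - i by ring, show i + -1 = i - 1 by ring, show i + -2 = i - 2 by ring,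
        show n - (i - 2) = n + 2 - i by ring]
      simp only [map_add, map_sub]
      push_cast
      ring
    simp only [s2, Finset.sum_sub_distrib, Finset.sum_add_distrib] at s1
    rw [sum_shift g1 n (-1) (fun i hi => by simp [hg1, hW i hi, hev]) (by norm_num) (by norm_num),
      sum_shift g2 n 0 (fun i hi => by simp [hg2, hW i hi, hev]) (by norm_num) (by norm_num),
      sum_shift g3 n 1 (fun i hi => by simp [hg3, hW i hi, hev]) (by norm_num) (by norm_num),
      sum_shift g4 n (-2) (fun i hi => by simp [hg4, hW i hi, hev]) (by norm_num) (by norm_num),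
      ← Finset.sum_add_distrib, ← Finset.sum_sub_distrib, ← Finset.sum_sub_distrib] at s1
    rw [← s1, _root_.sum_apply, _root_.sum_apply, Finset.mul_sum, ← Finset.sum_add_distrib, Finset.mul_sum]
    refine Finset.sum_congr rfl fun l _ => ?_
    rw [hL', hL']
    simp only [hg1, hg2, hg3, hg4, hev, hw', hp', hq', dx_h0', dx_h1', dy_h0', dy_h1']
    rw [show n + 1 - l = n - l + 1 by ring, show n + 2 - l = n - l + 2 by ring, show n - 1 - l = n - l - 1 by ring,
      zpow_add₀ hp0, zpow_add₀ hp0, zpow_add₀ hq0, zpow_add₀ hq0, zpow_sub_one₀ hp0, zpow_sub_one₀ hq0, zpow_one, zpow_one]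
    simp only [exS_mem _ hz]
    have hp1 : (((Real.sinh ζ.re)⁻¹ : ℝ) : ℂ) = pP ζ := rfl
    have hq1 : Complex.I * (((Real.cos ζ.im)⁻¹ : ℝ) : ℂ) = qQ ζ := rfl
    simp only [hp1, hq1]
    generalize pP ζ ^ l = A
    generalize qQ ζ ^ (n - l) = B
    have hs2 : Real.cosh ζ.re ^ 2 - 1 = Real.sinh ζ.re ^ 2 := by rw [Real.cosh_sq]; ring
    have hc2 : 1 - Real.sin ζ.im ^ 2 = Real.cos ζ.im ^ 2 := by rw [← Real.sin_sq_add_cos_sq ζ.im]; ring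
    have hX : evp ⟨_, hz⟩ sX = Real.cosh ζ.re := rfl
    have hY : evp ⟨_, hz⟩ sY = Real.sin ζ.im := rfl
    simp only [h0, h1, map_add, map_sub, map_mul, map_pow, map_one, map_ofNat, map_intCast, evp_cst, hX, hY, hs2, hc2]
    have hP : pP ζ = ((Real.sinh ζ.re : ℝ) : ℂ)⁻¹ := by simp [pP]
    have hQ : qQ ζ = Complex.I * ((Real.cos ζ.im : ℝ) : ℂ)⁻¹ := by simp [qQ]
    have hQ' : (qQ ζ)⁻¹ = - Complex.I * ((Real.cos ζ.im : ℝ) : ℂ) := by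
      rw [hQ, mul_inv, inv_inv, Complex.inv_I]
    rw [hQ', hP, hQ]
    have hs' : ((Real.sinh ζ.re : ℝ) : ℂ) ≠ 0 := by exact_mod_cast hs
    have hc' : ((Real.cos ζ.im : ℝ) : ℂ) ≠ 0 := by exact_mod_cast hc
    simp only [Complex.ofReal_add, Complex.ofReal_sub, Complex.ofReal_mul, Complex.ofReal_div, Complex.ofReal_pow, Complex.ofReal_neg,
      Complex.ofReal_one, Complex.ofReal_ofNat, Complex.ofReal_intCast, Complex.I_re, Complex.I_im, Complex.one_re, Complex.one_im,
      Complex.ofReal_zero]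
    generalize ((Real.sinh ζ.re : ℝ) : ℂ) = s at *
    generalize ((Real.cos ζ.im : ℝ) : ℂ) = c at *
    generalize ((Real.cosh ζ.re : ℝ) : ℂ) = x at *
    generalize ((Real.sin ζ.im : ℝ) : ℂ) = y at *
    simp only [mul_zero, mul_one, add_zero, zero_add, zpow_ofNat, mul_pow, Complex.I_sq]
    field_simp
    ring_nf
    simp only [Complex.I_sq, Complex.I_pow_three, Complex.I_pow_four]
    ring
  rcases mul_eq_zero.1 key with h | h
  · exact absurd h (by exact_mod_cast hA)
  · rw [smul_eq_mul]
    linear_combination (-Complex.I) * h + (∑ i ∈ Finset.Icc 0 n, L i) Complex.I * Complex.I_sq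
theorem FF_zero (n : ℤ) (W : ℤ → Sm) (hW : ∀ i, i < 0 ∨ n < i → W i = 0) (hE : ∀ i, eN n i W = 0)
    (h0 : ∀ i x hx, evp (pt x hx) (W i) = 0) (ζ : ℂ) (hζ : ζ ∈ dom) : FF n W ζ = 0 := by
  have han : AnalyticOnNhd ℂ (FF n W) dom :=
    DifferentiableOn.analyticOnNhd (fun z hz => (FF_diff n W hW hE z hz).differentiableWithinAt) isOpen_dom
  have h1 : (1 : ℂ) ∈ dom := ⟨by simp, by simp; positivity, by simp; positivity⟩
  refine han.eqOn_zero_of_preconnected_of_frequently_eq_zero conv_dom.isPreconnected h1 ?_ hζ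
  have hr : ∀ r : ℝ, 0 < r → FF n W r = 0 := by
    intro r hr
    apply Finset.sum_eq_zero
    intro i _
    have := h0 i (Real.cosh r) (Real.one_lt_cosh.2 hr.ne')
    rw [← exS_pt] at this
    simp [this]
  rw [Filter.frequently_iff_seq_forall]
  refine ⟨fun k => ((1 + 1 / ((k : ℝ) + 1) : ℝ) : ℂ), ?_, fun k => hr _ (by positivity)⟩
  rw [tendsto_nhdsWithin_iff]
  constructor
  · have h3 : Filter.Tendsto (fun k : ℕ => (1 + 1 / ((k : ℝ) + 1) : ℝ)) Filter.atTop (nhds (1 + 0)) :=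
      tendsto_const_nhds.add tendsto_one_div_add_atTop_nhds_zero_nat
    have h4 := (Complex.continuous_ofReal.tendsto _).comp h3
    rw [add_zero] at h4
    exact h4
  · refine Filter.Eventually.of_forall fun k => ?_
    simp only [Set.mem_compl_iff, Set.mem_singleton_iff]
    intro h
    have h' : (1 + 1 / ((k : ℝ) + 1) : ℝ) = 1 := by exact_mod_cast h
    have : 0 < 1 / ((k : ℝ) + 1) := by positivity
    linarith
theorem tele {h0 h1 P Q : ℂ} (hPQ : h0 * P ^ 2 + h1 * Q ^ 2 = 0) (w q : ℕ → ℂ) (e0 : w 0 = h1 * q 0) (e1 : w 1 = h1 * q 1)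
    (e : ∀ k, w (k + 2) = h0 * q k + h1 * q (k + 2)) (n : ℕ) :
    ∑ i ∈ Finset.range (n + 2), w i * P ^ i * Q ^ (n + 1 - i) = h1 * P ^ n * (q n * Q + q (n + 1) * P) := by
  induction n with
  | zero => simp [Finset.sum_range_succ, e0, e1]; ring
  | succ n ih =>
    rw [Finset.sum_range_succ]
    have : ∑ i ∈ Finset.range (n + 2), w i * P ^ i * Q ^ (n + 1 + 1 - i)
        = (∑ i ∈ Finset.range (n + 2), w i * P ^ i * Q ^ (n + 1 - i)) * Q := by
      rw [Finset.sum_mul]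
      refine Finset.sum_congr rfl fun i hi => ?_
      simp at hi
      rw [show n + 1 + 1 - i = n + 1 - i + 1 by omega]; ring
    rw [this, ih, e n, show n + 1 + 1 - (n + 2) = 0 by omega]
    linear_combination P ^ n * q n * hPQ
theorem FF_nat (n : ℕ) (W : ℤ → Sm) (ζ : ℂ) : FF n W ζ =
    ∑ i ∈ Finset.range (n + 1), ((exS (W i) (Real.cosh ζ.re, Real.sin ζ.im) : ℝ) : ℂ) * pP ζ ^ i * qQ ζ ^ (n - i) := by
  unfold FF
  symm
  refine Finset.sum_bij (fun i _ => (i : ℤ)) ?_ ?_ ?_ ?_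
  · intro a ha; simp at ha ⊢; omega
  · intro a _ b _ h; simpa using h
  · intro b hb; simp at hb; exact ⟨b.toNat, by simp; omega, by omega⟩
  · intro a ha
    simp at ha
    rw [show (n : ℤ) - a = ((n - a : ℕ) : ℤ) by omega, zpow_natCast, zpow_natCast]
def g1 : Sm := 2 * ((sX + 1) ^ 6 * (sX - 1) ^ 2 * sS ^ 3 * sB)
theorem g1_mul : g1 * h1 = 1 := by
  apply Sm_ext; intro z
  have a1 := congrArg (evp z) sE_mul
  have a2 := congrArg (evp z) sF_mul
  have a3 := congrArg (evp z) sB_mul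
  have a4 := congrArg (evp z) sS_mul
  simp only [g1, h1, aA, map_mul, map_add, map_sub, map_pow, map_one, evp_cst, map_ofNat] at *
  have : ∀ X Y E F B S : ℝ, E * (X + 1) = 1 → F * (X - 1) = 1 → B * (1 - Y ^ 2) = 1 → S * (X ^ 2 - Y ^ 2) = 1 →
    2 * ((X + 1) ^ 6 * (X - 1) ^ 2 * S ^ 3 * B) * (1 / 2 * ((X ^ 2 - Y ^ 2) ^ 3 * E ^ 6 * F ^ 2) * (1 - Y ^ 2)) = 1 := by
    intro X Y E F B S b1 b2 b3 b4
    calc _ = (E * (X + 1)) ^ 6 * (F * (X - 1)) ^ 2 * (B * (1 - Y ^ 2)) * (S * (X ^ 2 - Y ^ 2)) ^ 3 := by ring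
      _ = 1 := by rw [b1, b2, b3, b4]; ring
  exact this _ _ _ _ _ _ a1 a2 a3 a4
def Qr (W : ℤ → Sm) : ℕ → Sm
  | 0 => g1 * W 0
  | 1 => g1 * W 1
  | (k + 2) => g1 * (W (k + 2 : ℕ) - h0 * Qr W k)
theorem om_dom (z : Om) : ∃ ζ ∈ dom, (Real.cosh ζ.re, Real.sin ζ.im) = z.1 := by
  refine ⟨⟨Real.arcosh z.1.1, Real.arcsin z.1.2⟩, ⟨Real.arcosh_pos z.2.1, ?_, ?_⟩, ?_⟩
  · exact Real.neg_pi_div_two_lt_arcsin.2 z.2.2.1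
  · exact Real.arcsin_lt_pi_div_two.2 z.2.2.2
  · rw [Real.cosh_arcosh z.2.1.le, Real.sin_arcsin z.2.2.1.le z.2.2.2.le]
theorem Qr_top (n : ℕ) (W : ℤ → Sm) (hF : ∀ ζ ∈ dom, FF (n + 1 : ℕ) W ζ = 0) : Qr W n = 0 ∧ Qr W (n + 1) = 0 := by
  suffices h : ∀ z, evp z (Qr W n) = 0 ∧ evp z (Qr W (n + 1)) = 0 from
    ⟨Sm_ext fun z => by rw [(h z).1, map_zero], Sm_ext fun z => by rw [(h z).2, map_zero]⟩
  intro z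
  obtain ⟨ζ, hζ, e⟩ := om_dom z
  have h := hF ζ hζ
  have hs : Real.sinh ζ.re ≠ 0 := (Real.sinh_pos_iff.2 hζ.1).ne'
  have hc : Real.cos ζ.im ≠ 0 := (Real.cos_pos_of_mem_Ioo ⟨hζ.2.1, hζ.2.2⟩).ne'
  have hs2 : z.1.1 ^ 2 - 1 = Real.sinh ζ.re ^ 2 := by rw [← e, Real.cosh_sq]; ring
  have hc2 : 1 - z.1.2 ^ 2 = Real.cos ζ.im ^ 2 := by
    rw [← e]; have := Real.sin_sq_add_cos_sq ζ.im; simp only; linarith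
  have hg := congrArg (evp z) g1_mul
  rw [map_mul, map_one] at hg
  have hh1 : evp z h1 ≠ 0 := right_ne_zero_of_mul_eq_one hg
  rw [FF_nat, e] at h
  simp only [exS_of] at h
  have hrec : ∀ a b : Sm, evp z a = evp z h1 * evp z (g1 * a) := by
    intro a b; rw [map_mul, ← mul_assoc, mul_comm (evp z h1), hg, one_mul]
  have ht := tele (h0 := (evp z h0 : ℝ)) (h1 := (evp z h1 : ℝ)) (P := pP ζ) (Q := qQ ζ) ?_
    (fun i => ((evp z (W i) : ℝ) : ℂ)) (fun i => ((evp z (Qr W i) : ℝ) : ℂ)) ?_ ?_ ?_ n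
  · rw [ht] at h
    have hp0 : pP ζ ≠ 0 := Complex.ofReal_ne_zero.2 (inv_ne_zero hs)
    rcases mul_eq_zero.1 h with h | h
    · exact absurd h (mul_ne_zero (Complex.ofReal_ne_zero.2 hh1) (pow_ne_zero _ hp0))
    · have hre := congrArg Complex.re h
      have him := congrArg Complex.im h
      simp only [pP, qQ, Complex.add_re, Complex.add_im, Complex.mul_re, Complex.mul_im, Complex.ofReal_re, Complex.ofReal_im,
        Complex.I_re, Complex.I_im, Complex.zero_re, Complex.zero_im, mul_zero, zero_mul, sub_zero, add_zero, zero_add, one_mul, mul_eq_zero, inv_eq_zero, hs, hc, or_false] at hre him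
      exact ⟨him, hre⟩
  · simp only [pP, qQ, h0, h1, map_mul, map_sub, map_pow, map_one, evp_cst]
    rw [show evp z sX = z.1.1 from rfl, show evp z sY = z.1.2 from rfl, hs2, hc2, mul_pow, Complex.I_sq]
    simp only [Complex.ofReal_mul, Complex.ofReal_pow, Complex.ofReal_inv]
    have hs' : ((Real.sinh ζ.re : ℝ) : ℂ) ≠ 0 := Complex.ofReal_ne_zero.2 hs
    have hc' : ((Real.cos ζ.im : ℝ) : ℂ) ≠ 0 := Complex.ofReal_ne_zero.2 hc
    field_simp
    ring
  · rw [← Complex.ofReal_mul]; congr 1; exact hrec _ 0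
  · rw [← Complex.ofReal_mul]; congr 1; exact hrec _ 0
  · intro k
    rw [← Complex.ofReal_mul, ← Complex.ofReal_mul, ← Complex.ofReal_add]; congr 1
    have := hrec (W (k + 2 : ℕ) - h0 * Qr W k) 0
    rw [Qr, ← this, map_sub, map_mul]; ring
theorem eN_ind (n i : ℤ) (W V : ℤ → Sm) (h : ∀ i, W i = h0 * V (i - 2) + h1 * V i) :
    eN n i W = h0 * eN (n - 2) (i - 2) V + h1 * eN (n - 2) i V := by
  simp only [eN, h, map_add, Derivation.leibniz, smul_eq_mul]
  rw [show i + 1 - 2 = i - 1 by ring, show i - 2 + 1 = i - 1 by ring, show i - 1 - 2 = i - 3 by ring,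
    show i - 2 - 1 = i - 3 by ring]
  push_cast
  ring
theorem cauchy (n : ℕ) : ∀ (W : ℤ → Sm), (∀ i, i < 0 ∨ (n : ℤ) < i → W i = 0) → (∀ i, eN n i W = 0) →
    (∀ i x hx, evp (pt x hx) (W i) = 0) → ∀ i, W i = 0 := by
  induction n using Nat.strong_induction_on with
  | _ n ih =>
  intro W hW hE h0W
  have hF : ∀ ζ ∈ dom, FF n W ζ = 0 := fun ζ hζ => FF_zero n W hW hE h0W ζ hζ
  rcases n with _ | n
  · intro i
    by_cases hi : i = 0
    · subst hi
      apply Sm_ext; intro z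
      obtain ⟨ζ, hζ, e⟩ := om_dom z
      have h := hF ζ hζ
      rw [FF_nat, e] at h
      simpa [exS_of] using h
    · apply hW; omega
  · obtain ⟨q1, q2⟩ := Qr_top n W hF
    have hQ0 : ∀ k, n ≤ k → Qr W k = 0 ∧ Qr W (k + 1) = 0 := by
      intro k hk
      induction k, hk using Nat.le_induction with
      | base => exact ⟨q1, q2⟩
      | succ k hk ih' =>
        refine ⟨ih'.2, ?_⟩
        rw [Qr, ih'.1, hW _ (by push_cast; omega)]; simp
    set V : ℤ → Sm := fun i => if 0 ≤ i then Qr W i.toNat else 0 with hV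
    have hVneg : ∀ i, i < 0 → V i = 0 := fun i hi => by simp only [hV]; rw [if_neg (by omega)]
    have hWV : ∀ i, W i = h0 * V (i - 2) + h1 * V i := by
      intro i
      have hg : ∀ a : Sm, h1 * (g1 * a) = a := fun a => by rw [← mul_assoc, mul_comm h1, g1_mul, one_mul]
      rcases lt_trichotomy i 0 with hi | hi | hi
      · rw [hVneg i hi, hVneg (i - 2) (by omega), hW i (by omega)]; simp
      · subst hi
        rw [hVneg (0 - 2) (by omega)]; simp [hV, Qr, hg]
      · by_cases hi1 : i = 1
        · subst hi1
          rw [hVneg (1 - 2) (by omega)]; simp [hV, Qr, hg]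
        · obtain ⟨k, rfl⟩ : ∃ k : ℕ, i = (k + 2 : ℕ) := ⟨(i - 2).toNat, by omega⟩
          simp only [hV]
          rw [if_pos (by omega), if_pos (by omega), show (((k + 2 : ℕ) : ℤ) - 2).toNat = k by omega,
            show (((k + 2 : ℕ) : ℤ)).toNat = k + 2 by omega, Qr, hg]; ring
    have hVtop : ∀ i, (n : ℤ) ≤ i → V i = 0 := fun i hi => by
      simp only [hV]; rw [if_pos (by omega)]; exact (hQ0 _ (by omega)).1
    have hV0 : ∀ i x hx, evp (pt x hx) (V i) = 0 := by
      have : ∀ k : ℕ, ∀ x hx, evp (pt x hx) (Qr W k) = 0 ∧ evp (pt x hx) (Qr W (k + 1)) = 0 := by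
        intro k x hx
        induction k with
        | zero => simp [Qr, h0W]
        | succ k ih' =>
          refine ⟨ih'.2, ?_⟩
          rw [Qr, map_mul, map_sub, map_mul, ih'.1, h0W]; simp
      intro i x hx
      simp only [hV]
      split_ifs
      · exact (this _ x hx).1
      · simp
    have hVE : ∀ i, eN (n + 1 - 2) i V = 0 := by
      have hlow : ∀ i < -1, eN (n + 1 - 2) i V = 0 := by
        intro i hi
        simp [eN, hVneg (i - 1) (by omega), hVneg i (by omega), hVneg (i + 1) (by omega), hVneg (i - 2) (by omega)]
      have hst : ∀ i, eN (n + 1 - 2) (i - 2) V = 0 → eN (n + 1 - 2) i V = 0 := by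
        intro i hi
        have h2 := eN_ind (n + 1) i W V hWV
        have h3 := hE i
        push_cast at h3
        rw [h3, hi, mul_zero, zero_add] at h2
        calc _ = g1 * (h1 * eN (n + 1 - 2) i V) := by rw [← mul_assoc, g1_mul, one_mul]
          _ = 0 := by rw [← h2, mul_zero]
      have : ∀ k : ℕ, eN (n + 1 - 2) (-3 + k) V = 0 ∧ eN (n + 1 - 2) (-3 + (k + 1 : ℕ)) V = 0 := by
        intro k
        induction k with
        | zero => exact ⟨hlow _ (by omega), hlow _ (by omega)⟩
        | succ k ih' =>
          refine ⟨ih'.2, hst _ ?_⟩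
          rw [show -3 + ((k + 1 + 1 : ℕ) : ℤ) - 2 = -3 + k by push_cast; ring]; exact ih'.1
      intro i
      by_cases hi : i < -1
      · exact hlow i hi
      · have := (this (i + 3).toNat).1
        rwa [show -3 + ((i + 3).toNat : ℤ) = i by omega] at this
    have hVz : ∀ i, V i = 0 := by
      rcases n with _ | n
      · intro i
        rcases lt_or_ge i 0 with hi | hi
        · exact hVneg i hi
        · exact hVtop i (by simpa using hi)
      · refine ih n (by omega) V ?_ ?_ hV0
        · rintro i (hi | hi)
          · exact hVneg i hi
          · exact hVtop i (by push_cast; omega)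
        · intro i; have := hVE i
          rwa [show ((n + 1 : ℕ) : ℤ) + 1 - 2 = n by push_cast; ring] at this
    intro i
    rw [hWV, hVz, hVz]; simp
theorem Slice.null {v : ℤ → ℤ → ℤ → Sm} (hv : Slice v) (i j m : ℤ) : v i j m = 0 := by
  rcases lt_or_ge m 0 with hm | hm
  · exact hv.neg _ _ _ (by omega)
  obtain ⟨m', rfl⟩ := Int.eq_ofNat_of_zero_le hm
  induction m' using Nat.strong_induction_on generalizing i j with
  | _ m ih =>
  have hm2 : ∀ i j, v i j (m - 2) = 0 := by
    intro i j
    rcases lt_or_ge m 2 with h | h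
    · exact hv.neg _ _ _ (by omega)
    · have := ih (m - 2) (by omega) i j (by omega)
      rwa [show ((m - 2 : ℕ) : ℤ) = m - 2 by omega] at this
  rcases lt_or_ge (i + j) 0 with hij | hij
  · exact hv.neg _ _ _ (by omega)
  obtain ⟨n, hn⟩ := Int.eq_ofNat_of_zero_le hij
  have := cauchy n (fun i => v i (n - i) m) ?_ ?_ ?_ i
  · rwa [show (n : ℤ) - i = j by omega] at this
  · intro i hi; exact hv.neg _ _ _ (by omega)
  · intro i
    have := hv.eq i (n + 1 - i) m
    rw [hm2] at this
    simp only [eN]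
    rw [show (n : ℤ) + 1 - i - 1 = n - i by ring, show (n : ℤ) + 1 - i - 2 = n - (i + 1) by ring,
      show (n : ℤ) + 1 - i + 1 = n + 2 - i by ring] at this
    rw [show (n : ℤ) - (i - 1) = n + 1 - i by ring, show (n : ℤ) - (i - 2) = n + 2 - i by ring]
    linear_combination this
  · intro i x hx; exact hv.van _ _ _ _ _
end ZV

/-! ### Reduction to the slice `y = 0` and the base point -/
namespace ZV
open MvPolynomial
theorem null_of_line {P : RP} (hE : Eop P = 0) (hd : P.totalDegree ≤ 6)
    (hz : ∀ i k m x hx, evp (pt x hx) (uc P i 0 k m) = 0) : P = 0 := by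
  apply uc_zero
  intro i j k m
  rcases lt_or_ge k 0 with hk | hk
  · exact uc_neg P (by omega)
  obtain ⟨k', rfl⟩ := Int.eq_ofNat_of_zero_le hk
  induction k' using Nat.strong_induction_on generalizing i j m with
  | _ k ih =>
  have hk2 : ∀ i j m, uc P i j (k - 2) m = 0 := by
    intro i j m
    rcases lt_or_ge k 2 with h | h
    · exact uc_neg P (by omega)
    · have := ih (k - 2) (by omega) i j m (by omega)
      rwa [show ((k - 2 : ℕ) : ℤ) = k - 2 by omega] at this
  have hs : Slice (fun i j m => uc P i j k m) := by
    refine ⟨?_, ?_, ?_, ?_⟩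
    · intro i j m
      have := star hE i j k m
      rw [hk2, hk2, dy_h3] at this
      linear_combination this
    · intro i j m h; exact uc_neg P (by omega)
    · intro i j m h; exact uc_deg P hd (by omega)
    · intro i m x hx; exact hz _ _ _ _ _
  exact hs.null i j m
theorem ev_sY (x hx) : evp (pt x hx) sY = 0 := rfl
theorem dy_h2 (x hx) : evp (pt x hx) (dy h2) = 0 := by
  simp [h2, Derivation.leibniz, Derivation.leibniz_pow, ev_sY]
theorem star_line {P : RP} (hE : Eop P = 0) (i k m : ℤ) (x hx) :
    Nn x * (x ^ 2 - 1) * evp (pt x hx) (dx (uc P (i-1) 0 k m))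
    - Nn x * (2 - 3 / x) * (i - 1) * evp (pt x hx) (uc P (i-1) 0 k m)
    - (i + 1) * (evp (pt x hx) (dx h2) * evp (pt x hx) (uc P (i+1) 0 (k-2) m)
      + 2 * (x + 1) / (x - 1) ^ 3 * evp (pt x hx) (uc P (i+1) 0 k (m-2))) = 0 := by
  have e := congrArg (evp (pt x hx)) (star hE i 0 k m)
  rw [uc_neg P (show i < 0 ∨ (0 - 1 : ℤ) < 0 ∨ k < 0 ∨ m < 0 by omega),
    uc_neg P (show i + 1 < 0 ∨ (0 - 2 : ℤ) < 0 ∨ k < 0 ∨ m < 0 by omega), dy_h0, dy_h3] at e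
  simp only [map_add, map_sub, map_mul, map_zero, map_ofNat, map_intCast, ev_h0, ev_dxh0, ev_dxh3, ev_sY, dy_h2] at e
  push_cast at e
  linear_combination e
theorem step_up {P : RP} (hE : Eop P = 0) (i : ℤ) (hi : 0 < i + 1)
    (h : ∀ k m x hx, evp (pt x hx) (uc P (i-1) 0 k m) = 0) : ∀ k m x hx, evp (pt x hx) (uc P (i+1) 0 k m) = 0 := by
  intro k m x hx
  rcases lt_or_ge k 0 with hk | hk
  · rw [uc_neg P (by omega), map_zero]
  obtain ⟨k', rfl⟩ := Int.eq_ofNat_of_zero_le hk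
  induction k' using Nat.strong_induction_on generalizing m with
  | _ k ih =>
  have hk2 : ∀ m, evp (pt x hx) (uc P (i+1) 0 (k - 2) m) = 0 := by
    intro m
    rcases lt_or_ge k 2 with h | h
    · rw [uc_neg P (by omega), map_zero]
    · have := ih (k - 2) (by omega) m (by omega)
      rwa [show ((k - 2 : ℕ) : ℤ) = k - 2 by omega] at this
  have e := star_line hE i k (m + 2) x hx
  rw [hk2, h, line_zero (h k (m + 2)) x hx, show m + 2 - 2 = m by ring] at e
  have h1 : (i : ℝ) + 1 ≠ 0 := by
    have : (0 : ℝ) < i + 1 := by exact_mod_cast hi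
    exact this.ne'
  have h2 : 2 * (x + 1) / (x - 1) ^ 3 ≠ 0 := by
    have a1 : 0 < x - 1 := by linarith
    have a2 : 0 < x + 1 := by linarith
    positivity
  simp only [mul_zero, zero_add, sub_zero, zero_sub, neg_eq_zero, mul_eq_zero, h1, h2, false_or] at e
  exact e
theorem odd_zero {P : RP} (hE : Eop P = 0) (l : ℕ) : ∀ k m x hx, evp (pt x hx) (uc P (2 * l + 1) 0 k m) = 0 := by
  induction l with
  | zero =>
    have := step_up hE 0 (by norm_num) (fun k m x hx => by rw [uc_neg P (by omega), map_zero])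
    simpa using this
  | succ l ih =>
    have := step_up hE (2 * l + 2) (by omega) (by rw [show (2 * (l : ℤ) + 2 - 1) = 2 * l + 1 by ring]; exact ih)
    rwa [show (2 * (l : ℤ) + 2 + 1) = 2 * (l + 1 : ℕ) + 1 by push_cast; ring] at this
theorem line_null {P : RP} (hE : Eop P = 0) (hd : P.totalDegree ≤ 6)
    (hz : ∀ i k m, evp (pt 2 one_lt_two) (uc P i 0 k m) = 0) : ∀ i k m x hx, evp (pt x hx) (uc P i 0 k m) = 0 := by
  have big : ∀ i : ℤ, 6 < i → ∀ k m x hx, evp (pt x hx) (uc P i 0 k m) = 0 := by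
    intro i hi k m x hx
    by_cases h : k < 0 ∨ m < 0
    · rw [uc_neg P (by omega), map_zero]
    · rw [uc_deg P hd (by omega), map_zero]
  have main : ∀ l : ℕ, ∀ i : ℤ, 6 < i + l → ∀ k m x hx, evp (pt x hx) (uc P i 0 k m) = 0 := by
    intro l
    induction l with
    | zero => intro i hi; exact big i (by simpa using hi)
    | succ l ih =>
      intro i hi k m
      have hup := ih (i + 2) (by push_cast at hi; omega)
      have := lin_ode (ι := Unit) (fun _ x => exS (uc P i 0 k m) (x, 0)) (fun _ _ x => (2 - 3 / x) * i / (x ^ 2 - 1)) ?_ ?_ 2 one_lt_two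
        (fun _ => by rw [exS_pt _ 2 one_lt_two]; exact hz i k m) ()
      · intro x hx; rw [← exS_pt]; exact this x hx
      · intro _ _ x hx
        have h1 : (1:ℝ) < x := hx
        have h2 : x ≠ 0 := by linarith
        have h3 : x ^ 2 - 1 ≠ 0 := by nlinarith
        apply ContinuousAt.continuousWithinAt
        fun_prop (disch := assumption)
      · intro _ x hx
        refine (line_deriv (uc P i 0 k m) x hx).congr_deriv ?_
        have e := star_line hE (i + 1) k m x hx
        rw [show i + 1 + 1 = i + 2 by ring, hup, hup, show i + 1 - 1 = i by ring] at e
        have hN := (Nn_pos hx).ne'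
        have h3 : x ^ 2 - 1 ≠ 0 := by nlinarith
        simp only [Finset.univ_unique, Finset.sum_singleton, exS_pt _ x hx]
        push_cast at e
        have e' : Nn x * ((x ^ 2 - 1) * evp (pt x hx) (dx (uc P i 0 k m)) - (2 - 3 / x) * i * evp (pt x hx) (uc P i 0 k m)) = 0 := by
          linear_combination e
        rcases mul_eq_zero.1 e' with h | h
        · exact absurd h hN
        · rw [div_mul_eq_mul_div, eq_div_iff h3]; linear_combination h
  intro i k m x hx
  exact main (7 - i).toNat i (by omega) k m x hx
theorem uniq {P : RP} (hE : Eop P = 0) (hd : P.totalDegree ≤ 6)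
    (hz : ∀ i k m, evp (pt 2 one_lt_two) (uc P i 0 k m) = 0) : P = 0 :=
  null_of_line hE hd (line_null hE hd hz)
/-! the kernel of `Eop` is a subring -/
theorem Eop_mul (P Q : RP) (hP : Eop P = 0) (hQ : Eop Q = 0) : Eop (P * Q) = 0 := by
  apply Eop_zero
  intro z hz
  have h1 := pois_Ham P hz
  have h2 := pois_Ham Q hz
  have r0 : rep (0 : RP) z = 0 := by rw [rep_of _ hz, map_zero]
  rw [hP, r0, neg_zero] at h1
  rw [hQ, r0, neg_zero] at h2
  have e : rep (P * Q) =ᶠ[nhds z] (rep P * rep Q) := rep_ev (fun z hz => by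
      simp only [Pi.mul_apply, rep_of _ hz, map_mul]) hz
  have hpd : ∀ i, pd i (rep (P * Q)) z = rep P z * pd i (rep Q) z + rep Q z * pd i (rep P) z := by
    intro i
    simp only [pd]
    rw [e.fderiv_eq, fderiv_mul (rep_fderiv P hz).differentiableAt (rep_fderiv Q hz).differentiableAt]
    simp
  simp only [pois, hpd] at h1 h2 ⊢
  linear_combination rep P z * h2 + rep Q z * h1
theorem Eop_add (P Q : RP) : Eop (P + Q) = Eop P + Eop Q := by
  simp only [Eop, Dc_add, map_add]; ring
theorem Dc_X (D : Derivation ℝ Sm Sm) (n : Fin 4) : Dc D (X n) = 0 := by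
  have := Dc_mulX D (C 1) n
  rw [Dc_C, D.map_one_eq_zero] at this
  simpa using this
theorem Eop_cst (r : ℝ) : Eop (C (cst r)) = 0 := by
  simp [Eop, Dc_C]
theorem Eop_X2 : Eop (X 2) = 0 := by
  simp [Eop, Dc_X, pderiv_X]
theorem Eop_X3 : Eop (X 3) = 0 := by
  simp [Eop, Dc_X, pderiv_X]
theorem Eop_Hp : Eop Hp = 0 := by
  apply Eop_zero
  intro z hz
  simp only [pois, pd_Ham _ hz]; ring
def KE : Subsemiring RP where
  carrier := {P | Eop P = 0}
  mul_mem' ha hb := Eop_mul _ _ ha hb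
  one_mem' := by
    have := Eop_cst 1
    simpa [cst] using this
  add_mem' {a b} ha hb := by
    have ha' : Eop a = 0 := ha
    have hb' : Eop b = 0 := hb
    change Eop (a + b) = 0
    rw [Eop_add, ha', hb', add_zero]
  zero_mem' := by
    have := Eop_cst 0
    simpa [cst] using this
/-! slicing -/
abbrev o2 : Om := pt 2 one_lt_two
def sl : RP →+* MvPolynomial (Fin 4) ℝ :=
  eval₂Hom ((C : ℝ →+* MvPolynomial (Fin 4) ℝ).comp (evp o2 : Sm →+* ℝ)) ![X 0, 0, X 2, X 3]
theorem sl_C (a : Sm) : sl (C a) = C (evp o2 a) := by simp [sl]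
theorem sl_X (n) : sl (X n) = (![X 0, 0, X 2, X 3] : Fin 4 → MvPolynomial (Fin 4) ℝ) n := by simp [sl]
theorem monomial_four {R : Type*} [CommSemiring R] (s : Fin 4 →₀ ℕ) (a : R) :
    monomial s a = C a * (X 0 ^ s 0 * X 1 ^ s 1 * X 2 ^ s 2 * X 3 ^ s 3) := by
  rw [monomial_eq, Finsupp.prod_fintype _ _ (by simp), Fin.prod_univ_four]
theorem sl_monomial (s : Fin 4 →₀ ℕ) (a : Sm) : sl (monomial s a) = if s 1 = 0 then monomial s (evp o2 a) else 0 := by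
  rw [monomial_four, monomial_four]
  simp only [map_mul, map_pow, sl_C, sl_X]
  split_ifs with h
  · simp [h]
  · simp [h]
theorem coeff_sl (P : RP) (m : Fin 4 →₀ ℕ) : coeff m (sl P) = if m 1 = 0 then evp o2 (coeff m P) else 0 := by
  classical
  induction P using MvPolynomial.induction_on' with
  | monomial u a =>
    rw [sl_monomial, coeff_monomial, apply_ite (coeff m), coeff_monomial, coeff_zero]
    by_cases h : u = m
    · subst h; simp
    · simp [h]
  | add p q hp hq =>
    rw [map_add, coeff_add, hp, hq, coeff_add]
    split_ifs <;> simp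
theorem uc_nat (P : RP) (m : Fin 4 →₀ ℕ) : uc P (m 0) (m 1) (m 2) (m 3) = coeff m P := by
  unfold uc Uc
  rw [if_pos (by intro n; fin_cases n <;> simp)]
  have e : fs ![(m 0 : ℤ), m 1, m 2, m 3] = m := by
    ext n; fin_cases n <;> rfl
  rw [e]
theorem uc_sl {P : RP} (h : sl P = 0) (i k m : ℤ) : evp o2 (uc P i 0 k m) = 0 := by
  by_cases hn : i < 0 ∨ k < 0 ∨ m < 0
  · rw [uc_neg P (by omega), map_zero]
  have := coeff_sl P (fs ![i, 0, k, m])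
  rw [h, coeff_zero, if_pos (by rfl), ← uc_nat] at this
  have e0 : ((fs ![i, 0, k, m] 0 : ℕ) : ℤ) = i := by change ((i.toNat : ℕ) : ℤ) = i; omega
  have e1 : ((fs ![i, 0, k, m] 1 : ℕ) : ℤ) = 0 := rfl
  have e2 : ((fs ![i, 0, k, m] 2 : ℕ) : ℤ) = k := by change ((k.toNat : ℕ) : ℤ) = k; omega
  have e3 : ((fs ![i, 0, k, m] 3 : ℕ) : ℤ) = m := by change ((m.toNat : ℕ) : ℤ) = m; omega
  rw [e0, e1, e2, e3] at this
  exact this.symm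
def r0 : ℝ := evp o2 h0
def r2 : ℝ := evp o2 h2
def r3 : ℝ := evp o2 h3
theorem r0_ne : r0 ≠ 0 := by
  unfold r0
  rw [ev_h0]
  have := Nn_pos one_lt_two
  positivity
def Zp : RP := C (cst r0⁻¹) * (Hp + C (cst (-r2)) * X 2 ^ 2 + C (cst (-r3)) * X 3 ^ 2)
theorem sl_Zp : sl Zp = X 0 ^ 2 := by
  simp only [Zp, Hp, map_mul, map_add, map_pow, sl_C, sl_X, evp_cst]
  change C r0⁻¹ * (C r0 * X 0 ^ 2 + C (evp o2 h1) * 0 ^ 2 + C r2 * X 2 ^ 2 + C r3 * X 3 ^ 2 + C (-r2) * X 2 ^ 2 + C (-r3) * X 3 ^ 2) = _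
  have : (C r0⁻¹ : MvPolynomial (Fin 4) ℝ) * C r0 = 1 := by rw [← C_mul, inv_mul_cancel₀ r0_ne, C_1]
  simp only [C_neg]
  linear_combination X 0 ^ 2 * this
theorem Zp_KE : Zp ∈ KE :=
  mul_mem (Eop_cst _) (add_mem (add_mem Eop_Hp (mul_mem (Eop_cst _) (pow_mem Eop_X2 2))) (mul_mem (Eop_cst _) (pow_mem Eop_X3 2)))
theorem deg_CX2 (a : Sm) (n : Fin 4) : (C a * X n ^ 2 : RP).totalDegree ≤ 2 := by
  refine (totalDegree_mul _ _).trans ?_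
  have h1 : (X n ^ 2 : RP).totalDegree ≤ 2 * (X n : RP).totalDegree := totalDegree_pow _ _
  have h2 : (X n : RP).totalDegree ≤ 1 := by
    rw [X]; exact (totalDegree_monomial_le _ _).trans (by simp)
  rw [totalDegree_C]; omega
theorem deg_Zp : Zp.totalDegree ≤ 2 := by
  refine (totalDegree_mul _ _).trans ?_
  rw [totalDegree_C, zero_add]
  have add2 : ∀ p q : RP, p.totalDegree ≤ 2 → q.totalDegree ≤ 2 → (p + q).totalDegree ≤ 2 := fun p q hp hq =>
    (totalDegree_add _ _).trans (max_le hp hq)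
  unfold Hp
  repeat' first | exact deg_CX2 _ _ | apply add2
def Qt (c : ℝ) (a b e : ℕ) : RP := C (cst c) * Zp ^ a * X 2 ^ b * X 3 ^ e
theorem Qt_KE (c a b e) : Qt c a b e ∈ KE :=
  mul_mem (mul_mem (mul_mem (Eop_cst _) (pow_mem Zp_KE _)) (pow_mem Eop_X2 _)) (pow_mem Eop_X3 _)
theorem deg_Xpow (n : Fin 4) (b : ℕ) : (X n ^ b : RP).totalDegree ≤ b := by
  have h2 : (X n : RP).totalDegree ≤ 1 := by
    rw [X]; exact (totalDegree_monomial_le _ _).trans (by simp)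
  exact (totalDegree_pow _ _).trans (by nlinarith)
theorem deg_Qt (c a b e) : (Qt c a b e).totalDegree ≤ 2 * a + b + e := by
  unfold Qt
  refine (totalDegree_mul _ _).trans (add_le_add ((totalDegree_mul _ _).trans (add_le_add ((totalDegree_mul _ _).trans ?_) (deg_Xpow _ _))) (deg_Xpow _ _))
  rw [totalDegree_C, zero_add]
  refine (totalDegree_pow _ _).trans ?_
  have := deg_Zp
  nlinarith
theorem sl_Qt (c a b e) : sl (Qt c a b e) = C c * (X 0 ^ 2) ^ a * X 2 ^ b * X 3 ^ e := by
  simp only [Qt, map_mul, map_pow, sl_C, evp_cst, sl_Zp, sl_X]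
  simp
theorem exists_Q {P : RP} (hE : Eop P = 0) (hd : P.totalDegree ≤ 6) :
    ∃ (s : Finset (Fin 4 →₀ ℕ)) (c : (Fin 4 →₀ ℕ) → ℝ), (∀ m ∈ s, 2 * (m 0 / 2) + m 2 + m 3 ≤ 6) ∧
      P = ∑ m ∈ s, Qt (c m) (m 0 / 2) (m 2) (m 3) := by
  have hm : ∀ m ∈ (sl P).support, m 1 = 0 ∧ m 0 = 2 * (m 0 / 2) ∧ m 0 + m 2 + m 3 ≤ 6 := by
    intro m hm
    rw [mem_support_iff, coeff_sl] at hm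
    have h1 : m 1 = 0 := by by_contra h; simp [h] at hm
    rw [if_pos h1] at hm
    refine ⟨h1, ?_, ?_⟩
    · by_contra h
      apply hm
      rw [← uc_nat, h1]
      have := odd_zero hE (m 0 / 2) (m 2) (m 3) 2 one_lt_two
      rw [show (2 * ((m 0 / 2 : ℕ) : ℤ) + 1) = m 0 by omega] at this
      exact this
    · have h2 : coeff m P ≠ 0 := by intro h; rw [h, map_zero] at hm; exact hm rfl
      have h3 := le_totalDegree (mem_support_iff.2 h2)
      have h4 : (m.sum fun _ e => e) = m 0 + m 1 + m 2 + m 3 := by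
        rw [Finsupp.sum_fintype _ _ (by simp), Fin.sum_univ_four]
      omega
  refine ⟨(sl P).support, fun m => coeff m (sl P), fun m h => by have := hm m h; omega, ?_⟩
  set Q : RP := ∑ m ∈ (sl P).support, Qt (coeff m (sl P)) (m 0 / 2) (m 2) (m 3) with hQ
  have hQK : Eop Q = 0 := KE.sum_mem fun m _ => Qt_KE _ _ _ _
  have hQd : Q.totalDegree ≤ 6 := by
    refine totalDegree_finsetSum_le fun m h => (deg_Qt _ _ _ _).trans ?_
    have := hm m h; omega
  have hQs : sl Q = sl P := by
    rw [hQ, map_sum]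
    conv_rhs => rw [(sl P).as_sum]
    refine Finset.sum_congr rfl fun m h => ?_
    obtain ⟨h1, h2, -⟩ := hm m h
    rw [sl_Qt, monomial_four, ← pow_mul, ← h2, h1]; ring
  have hneg : C (cst (-1)) * Q = -Q := by
    have : (C (cst (-1)) : RP) = -1 := by simp [cst]
    rw [this]; ring
  have hD : P + C (cst (-1)) * Q = 0 := by
    refine uniq (KE.add_mem hE (KE.mul_mem (Eop_cst _) hQK)) ?_ ?_
    · refine (totalDegree_add _ _).trans (max_le hd ?_)
      rw [hneg, totalDegree_neg]; exact hQd
    · intro i k m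
      apply uc_sl
      rw [hneg, map_add, map_neg, hQs]; ring
  rw [hneg] at hD
  linear_combination hD
end ZV

namespace ZV
open MvPolynomial
open scoped ContDiff
/-! Part 0: from the integral to an element of the polynomial ring -/
theorem pd_proj (i j : Fin 8) (z : PhasePt) : pd i (fun w : PhasePt => w j) z = if j = i then 1 else 0 := by
  have h : HasFDerivAt (fun w : PhasePt => w j) (pj j) z := (pj j).hasFDerivAt
  unfold pd
  rw [h.fderiv]
  simp [pj, Pi.single_apply]
theorem pois_Pphi (I : PhasePt → ℝ) (z : PhasePt) : pois Pphi I z = - pd 2 I z := by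
  have h : ∀ i, pd i Pphi z = if (6 : Fin 8) = i then 1 else 0 := fun i => pd_proj i 6 z
  simp [pois, h]
theorem pois_Ptm (I : PhasePt → ℝ) (z : PhasePt) : pois Ptm I z = - pd 3 I z := by
  have h : ∀ i, pd i Ptm z = if (7 : Fin 8) = i then 1 else 0 := fun i => pd_proj i 7 z
  simp [pois, h]
/-- forget the cyclic coordinates -/
def forg (z : PhasePt) : PhasePt := ![z 0, z 1, 0, 0, z 4, z 5, z 6, z 7]
def cyc (z : PhasePt) : PhasePt := Pi.single 2 (z 2) + Pi.single 3 (z 3)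
theorem forg_add (z : PhasePt) : forg z + (1 : ℝ) • cyc z = z := by
  ext i; fin_cases i <;> simp [forg, cyc, Pi.single_apply]
theorem forg_mem {z : PhasePt} (hz : z ∈ TStar) (s : ℝ) : forg z + s • cyc z ∈ TStar := by
  have e0 : (forg z + s • cyc z) 0 = z 0 := by
    rw [Pi.add_apply, Pi.smul_apply]; simp [forg, cyc]
  have e1 : (forg z + s • cyc z) 1 = z 1 := by
    rw [Pi.add_apply, Pi.smul_apply]; simp [forg, cyc]
  unfold TStar
  rw [Set.mem_setOf_eq, e0, e1]
  exact hz
theorem forg_eq {I : PhasePt → ℝ} (hsm : ContDiffOn ℝ (⊤ : ℕ∞) I TStar)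
    (hphi : ∀ z ∈ TStar, pois Pphi I z = 0) (ht : ∀ z ∈ TStar, pois Ptm I z = 0)
    {z : PhasePt} (hz : z ∈ TStar) : I z = I (forg z) := by
  have hd : ∀ s : ℝ, HasDerivAt (fun s : ℝ => I (forg z + s • cyc z)) 0 s := by
    intro s
    have hm := forg_mem hz s
    have hI : DifferentiableAt ℝ I (forg z + s • cyc z) :=
      ((hsm.differentiableOn (by simp)).differentiableAt (isOpen_TStar.mem_nhds hm))
    have hl : HasDerivAt (fun s : ℝ => forg z + s • cyc z) (cyc z) s := by
      simpa using ((hasDerivAt_id s).smul_const (cyc z)).const_add (forg z)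
    have h := hI.hasFDerivAt.comp_hasDerivAt s hl
    have e : fderiv ℝ I (forg z + s • cyc z) (cyc z) = 0 := by
      have h2 := hphi _ hm
      have h3 := ht _ hm
      rw [pois_Pphi, neg_eq_zero] at h2
      rw [pois_Ptm, neg_eq_zero] at h3
      have e1 : cyc z = z 2 • (Pi.single 2 1 : PhasePt) + z 3 • (Pi.single 3 1 : PhasePt) := by
        ext i; simp [cyc, Pi.single_apply]
      unfold pd at h2 h3
      rw [e1] at h2 h3 ⊢
      rw [map_add, map_smul, map_smul, h2, h3]; simp
    rw [e] at h
    exact h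
  have h1 := is_const_of_deriv_eq_zero (fun s => (hd s).differentiableAt) (fun s => (hd s).deriv) 1 0
  simp only [forg_add, zero_smul, add_zero] at h1
  exact h1
theorem smooth_base {c : (Fin 4 → ℝ) → ℝ} (h : ContDiffOn ℝ (⊤ : ℕ∞) c Ubase) :
    ContDiffOn ℝ ∞ (fun w : ℝ × ℝ => c ![w.1, w.2, 0, 0]) Om := by
  have hg : ContDiff ℝ ∞ (fun w : ℝ × ℝ => (![w.1, w.2, 0, 0] : Fin 4 → ℝ)) := by
    rw [contDiff_pi]
    intro i
    fin_cases i
    · exact contDiff_fst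
    · exact contDiff_snd
    · exact contDiff_const
    · exact contDiff_const
  exact h.comp hg.contDiffOn (fun w hw => hw)
theorem exists_P {I : PhasePt → ℝ} (hsm : ContDiffOn ℝ (⊤ : ℕ∞) I TStar) (hpoly : IsPolyMom 6 I)
    (hphi : ∀ z ∈ TStar, pois Pphi I z = 0) (ht : ∀ z ∈ TStar, pois Ptm I z = 0) :
    ∃ P : RP, P.totalDegree ≤ 6 ∧ ∀ z ∈ TStar, rep P z = I z := by
  obtain ⟨c, hc, hI⟩ := hpoly
  refine ⟨∑ i ∈ range 7, ∑ j ∈ range 7, ∑ k ∈ range 7, ∑ m ∈ range 7,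
    if i + j + k + m ≤ 6 then C (mkS _ (smooth_base (hc i j k m))) * X 0 ^ i * X 1 ^ j * X 2 ^ k * X 3 ^ m else 0, ?_, ?_⟩
  · refine totalDegree_finsetSum_le fun i _ => totalDegree_finsetSum_le fun j _ =>
      totalDegree_finsetSum_le fun k _ => totalDegree_finsetSum_le fun m _ => ?_
    split_ifs with h
    · have h1 : ∀ a : Sm, (C a * X 0 ^ i * X 1 ^ j * X 2 ^ k * X 3 ^ m : RP).totalDegree ≤ 0 + i + j + k + m := by
        intro a
        refine (totalDegree_mul _ _).trans (add_le_add ((totalDegree_mul _ _).trans (add_le_add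
          ((totalDegree_mul _ _).trans (add_le_add ((totalDegree_mul _ _).trans
            (add_le_add ?_ (deg_Xpow _ _))) (deg_Xpow _ _))) (deg_Xpow _ _))) (deg_Xpow _ _))
        simp
      exact (h1 _).trans (by omega)
    · simp
  · intro z hz
    have hf : forg z ∈ TStar := by simpa using forg_mem hz 0
    rw [forg_eq hsm hphi ht hz, hI _ hf, rep_of _ hz]
    simp only [map_sum]
    refine Finset.sum_congr rfl fun i _ => Finset.sum_congr rfl fun j _ => Finset.sum_congr rfl fun k _ =>
      Finset.sum_congr rfl fun m _ => ?_
    have e : basePt (forg z) = ![z 0, z 1, 0, 0] := by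
      ext q; fin_cases q <;> rfl
    rw [e]
    split_ifs
    · simp only [map_mul, map_pow, evm_C, evm_X, evp_mkS]
      rfl
    · simp
/-! Final part: from `Zp` back to the Hamiltonian -/
def Wd (d : ℕ) : Submodule ℝ (PhasePt → ℝ) :=
  Submodule.span ℝ {f | ∃ a b e, 2 * a + b + e ≤ d ∧ f = fun z => Ham z ^ a * z 6 ^ b * z 7 ^ e}
theorem Wd_mono {d d' : ℕ} (h : d ≤ d') : Wd d ≤ Wd d' :=
  Submodule.span_mono fun _ ⟨a, b, e, h1, h2⟩ => ⟨a, b, e, h1.trans h, h2⟩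
theorem Wd_mulmon (a' b' e' : ℕ) {d : ℕ} {f : PhasePt → ℝ} (hf : f ∈ Wd d) :
    (fun z => f z * (Ham z ^ a' * z 6 ^ b' * z 7 ^ e')) ∈ Wd (d + (2 * a' + b' + e')) := by
  induction hf using Submodule.span_induction with
  | mem f hf =>
    obtain ⟨a, b, e, h1, rfl⟩ := hf
    refine Submodule.subset_span ⟨a + a', b + b', e + e', by omega, ?_⟩
    funext z; ring
  | zero =>
    convert (Wd (d + (2 * a' + b' + e'))).zero_mem using 1
    funext z; simp
  | add f g _ _ h1 h2 =>
    convert (Wd _).add_mem h1 h2 using 1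
    funext z; simp only [Pi.add_apply]; ring
  | smul r f _ h =>
    convert (Wd _).smul_mem r h using 1
    funext z; simp only [Pi.smul_apply, smul_eq_mul]; ring
def Zf (z : PhasePt) : ℝ := r0⁻¹ * (Ham z + (-r2) * z 6 ^ 2 + (-r3) * z 7 ^ 2)
theorem Wd_Zf {d : ℕ} {f : PhasePt → ℝ} (hf : f ∈ Wd d) : (fun z => f z * Zf z) ∈ Wd (d + 2) := by
  have h1 := (Wd _).smul_mem r0⁻¹ (Wd_mulmon 1 0 0 hf)
  have h2 := (Wd _).smul_mem (-(r0⁻¹ * r2)) (Wd_mulmon 0 2 0 hf)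
  have h3 := (Wd _).smul_mem (-(r0⁻¹ * r3)) (Wd_mulmon 0 0 2 hf)
  convert (Wd _).add_mem ((Wd _).add_mem h1 h2) h3 using 1
  funext z; simp only [Pi.add_apply, Pi.smul_apply, smul_eq_mul, Zf]; ring
theorem Wd_Zpow (c : ℝ) (a : ℕ) : (fun z => c * Zf z ^ a) ∈ Wd (2 * a) := by
  induction a with
  | zero =>
    have h : (fun z => Ham z ^ 0 * z 6 ^ 0 * z 7 ^ 0) ∈ Wd (2 * 0) := Submodule.subset_span ⟨0, 0, 0, by omega, rfl⟩
    convert (Wd _).smul_mem c h using 1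
    funext z; simp
  | succ a ih =>
    have h := Wd_Zf ih
    rw [show 2 * (a + 1) = 2 * a + 2 by ring]
    convert h using 1
    funext z; ring
theorem Wd_Qt (c : ℝ) {a b e : ℕ} (h : 2 * a + b + e ≤ 6) : (fun z => c * Zf z ^ a * z 6 ^ b * z 7 ^ e) ∈ Wd 6 := by
  have := Wd_mono (by omega : 2 * a + (2 * 0 + b + e) ≤ 6) (Wd_mulmon 0 b e (Wd_Zpow c a))
  convert this using 1
  funext z; ring
theorem rep_Qt (c : ℝ) (a b e : ℕ) {z : PhasePt} (hz : z ∈ TStar) :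
    rep (Qt c a b e) z = c * Zf z ^ a * z 6 ^ b * z 7 ^ e := by
  have hH := rep_Hp hz
  rw [rep_of _ hz] at hH ⊢
  simp only [Qt, Zp, map_mul, map_pow, map_add, evm_C, evm_X, evp_cst, hH, Zf]
  rfl
theorem Wd_out {f : PhasePt → ℝ} (hf : f ∈ Wd 6) : ∃ c : ℕ → ℕ → ℕ → ℝ, ∀ z,
      f z = ∑ a ∈ Finset.range 7, ∑ b ∈ Finset.range 7, ∑ e ∈ Finset.range 7,
        (if 2*a + b + e ≤ 6 then c a b e * (Ham z)^a * (z 6)^b * (z 7)^e else 0) := by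
  induction hf using Submodule.span_induction with
  | mem f hf =>
    obtain ⟨a, b, e, h1, rfl⟩ := hf
    refine ⟨fun a' b' e' => if a' = a then if b' = b then if e' = e then 1 else 0 else 0 else 0, fun z => ?_⟩
    rw [Finset.sum_eq_single_of_mem a (by simp; omega), Finset.sum_eq_single_of_mem b (by simp; omega),
      Finset.sum_eq_single_of_mem e (by simp; omega)]
    · simp [h1]
    · intro e' _ h; simp [h]
    · intro b' _ h; simp [h]
    · intro a' _ h; simp [h]
  | zero => exact ⟨fun _ _ _ => 0, fun z => by simp⟩
  | add f g _ _ h1 h2 =>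
    obtain ⟨c1, h1⟩ := h1
    obtain ⟨c2, h2⟩ := h2
    refine ⟨fun a b e => c1 a b e + c2 a b e, fun z => ?_⟩
    rw [Pi.add_apply, h1, h2]
    simp only [← Finset.sum_add_distrib]
    refine Finset.sum_congr rfl fun i _ => Finset.sum_congr rfl fun j _ => Finset.sum_congr rfl fun k _ => ?_
    split_ifs
    · ring
    · simp
  | smul r f _ h =>
    obtain ⟨c, h⟩ := h
    refine ⟨fun a b e => r * c a b e, fun z => ?_⟩
    rw [Pi.smul_apply, h, smul_eq_mul]
    simp only [Finset.mul_sum]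
    refine Finset.sum_congr rfl fun i _ => Finset.sum_congr rfl fun j _ => Finset.sum_congr rfl fun k _ => ?_
    split_ifs
    · ring
    · simp
theorem final {I : PhasePt → ℝ}
    (hsm : ContDiffOn ℝ (⊤ : ℕ∞) I TStar) (hpoly : IsPolyMom 6 I)
    (hH : ∀ z ∈ TStar, pois Ham I z = 0)
    (hphi : ∀ z ∈ TStar, pois Pphi I z = 0)
    (ht : ∀ z ∈ TStar, pois Ptm I z = 0) : ∃ f ∈ Wd 6, ∀ z ∈ TStar, I z = f z := by
  obtain ⟨P, hd, hP⟩ := exists_P hsm hpoly hphi ht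
  have hE : Eop P = 0 := Eop_zero fun z hz => by
    rw [← hH z hz]
    unfold pois pd
    rw [(rep_ev hP hz).fderiv_eq]
  obtain ⟨s, c, hs, hQ⟩ := exists_Q hE hd
  refine ⟨∑ m ∈ s, fun z => c m * Zf z ^ (m 0 / 2) * z 6 ^ m 2 * z 7 ^ m 3,
    Submodule.sum_mem _ fun m hm => Wd_Qt _ (hs m hm), fun z hz => ?_⟩
  rw [← hP z hz, hQ, rep_of _ hz, map_sum, Finset.sum_apply]
  refine Finset.sum_congr rfl fun m _ => ?_
  rw [← rep_of _ hz, rep_Qt _ _ _ _ hz]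
end ZV

/-- every degree ≤ 6 polynomial-in-momenta integral commuting with `p_φ, p_t`
is a polynomial in `H`, `p_φ`, `p_t`. -/
theorem degree_le_six_integrals_are_trivial (I : PhasePt → ℝ)
    (hsm : ContDiffOn ℝ (⊤ : ℕ∞) I TStar) (hpoly : IsPolyMom 6 I)
    (hH : ∀ z ∈ TStar, pois Ham I z = 0)
    (hphi : ∀ z ∈ TStar, pois Pphi I z = 0)
    (ht : ∀ z ∈ TStar, pois Ptm I z = 0) :
    ∃ c : ℕ → ℕ → ℕ → ℝ, ∀ z ∈ TStar,
      I z = ∑ a ∈ Finset.range 7, ∑ b ∈ Finset.range 7, ∑ e ∈ Finset.range 7,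
        (if 2*a + b + e ≤ 6 then c a b e * (Ham z)^a * (z 6)^b * (z 7)^e else 0) := by
  obtain ⟨f, hf, hI⟩ := ZV.final hsm hpoly hH hphi ht
  obtain ⟨c, hc⟩ := ZV.Wd_out hf
  exact ⟨c, fun z hz => (hI z hz).trans (hc z)⟩

end
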